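/- arXiv:math/0001116 — 3 statements merged into one kernel-verified Lean document; each statement's English description precedes it below -/
import Mathlib

section
/- In this setting the following identities hold on Ω, for all indices A, B, C, E ∈ {1,…,n} (sums over repeated capital indices running from 1 to n): (1) ξ·h_{ĀB} = Σ_{C,D} γ^D_B·conj(γ^C_A)·(ĥ_{C̄D} ∘ f); (2) L_Ā γ^E_B + η^E·h_{ĀB} = 0; (3) L_Ā ξ + ξ·h_Ā = ξ·Σ_C conj(γ^C_A)·(ĥ_C̄ ∘ f) + Σ_{C,D} conj(γ^C_A)·η^D·(ĥ_{C̄D} ∘ f); (4) L_Ā η^C + η^C·h_Ā = 0; (5) T γ^C_A − L_A η^C − η^C·conj(h_Ā) = 0. -/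
open scoped Topology

noncomputable section

/-- A complex vector field on (an open subset of) `ℝ^m`, given by its components:
it acts on functions by `(Xu)(x) = Du(x)·X(x)`. -/
abbrev VF (m : ℕ) := (Fin m → ℝ) → Fin m → ℂ

/-- The action `(Xu)(x) = Du(x)·X(x)` of a complex vector field on a function. -/
noncomputable def vapp {m : ℕ} (X : VF m) (u : (Fin m → ℝ) → ℂ) (x : Fin m → ℝ) : ℂ :=
  ∑ i, X x i * fderiv ℝ u x (Pi.single i 1)

/-- The Lie bracket `[X,Y](x) = DY(x)·X(x) − DX(x)·Y(x)` of complex vector fields. -/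
noncomputable def vbrk {m : ℕ} (X Y : VF m) : VF m :=
  fun x j => vapp X (fun y => Y y j) x - vapp Y (fun y => X y j) x

/-- The componentwise complex conjugate `X̄` of a complex vector field. -/
def vconj {m : ℕ} (X : VF m) : VF m := fun x i => (starRingEnd ℂ) (X x i)

/-- A normalized frame (Lemma 1.33): `T, L_A, L_Ā` is a smooth pointwise basis of `ℂ^{2n+1}`
on `Ω` with `T` real, `[L_A, L_B] = 0`, `[L_Ā, L_B] = −h_{ĀB}·T`, `[L_Ā, T] = −h_Ā·T`, and
each `[L_A, T]` a smooth multiple of `T`.  The fields `lv` and `hb` are the Levi functions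
`h_{ĀB}` and `h_Ā`. -/
structure NFrame (n : ℕ) (Ω : Set (Fin (2 * n + 1) → ℝ)) (T : VF (2 * n + 1))
    (L : Fin n → VF (2 * n + 1))
    (lv : Fin n → Fin n → (Fin (2 * n + 1) → ℝ) → ℂ)
    (hb : Fin n → (Fin (2 * n + 1) → ℝ) → ℂ) : Prop where
  open_Ω : IsOpen Ω
  mem0 : (0 : Fin (2 * n + 1) → ℝ) ∈ Ω
  smoothT : ContDiffOn ℝ (⊤ : ℕ∞) T Ω
  smoothL : ∀ A, ContDiffOn ℝ (⊤ : ℕ∞) (L A) Ω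
  smooth_lv : ∀ A B, ContDiffOn ℝ (⊤ : ℕ∞) (lv A B) Ω
  smooth_hb : ∀ A, ContDiffOn ℝ (⊤ : ℕ∞) (hb A) Ω
  Treal : ∀ x i, (starRingEnd ℂ) (T x i) = T x i
  indep : ∀ x ∈ Ω, LinearIndependent ℂ
    (Sum.elim (fun _ : Fin 1 => T x) (Sum.elim (fun A => L A x) (fun A => vconj (L A) x)))
  spans : ∀ x ∈ Ω, Submodule.span ℂ
    (Set.range (Sum.elim (fun _ : Fin 1 => T x)
      (Sum.elim (fun A => L A x) (fun A => vconj (L A) x)))) = ⊤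
  commLL : ∀ A B, ∀ x ∈ Ω, vbrk (L A) (L B) x = 0
  commLbL : ∀ A B, ∀ x ∈ Ω, vbrk (vconj (L A)) (L B) x = fun i => -(lv A B x) * T x i
  commLbT : ∀ A, ∀ x ∈ Ω, vbrk (vconj (L A)) T x = fun i => -(hb A x) * T x i
  commLT : ∀ A, ∃ c : (Fin (2 * n + 1) → ℝ) → ℂ, ContDiffOn ℝ (⊤ : ℕ∞) c Ω ∧
    ∀ x ∈ Ω, vbrk (L A) T x = fun i => c x * T x i

/-- Auxiliary: the iterated Levi function `h_{Ā₁…Ā_k}` (`T`-component), with the index list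
given in *reverse* order `[A_k,…,A₁]`, defined by the recursion
`h_{Ās C̄} = L_C̄ h_{Ās} + h_{Ās}·h_C̄`. -/
noncomputable def hTrev {n : ℕ} (L : Fin n → VF (2 * n + 1))
    (hb : Fin n → (Fin (2 * n + 1) → ℝ) → ℂ) :
    List (Fin n) → (Fin (2 * n + 1) → ℝ) → ℂ
  | [] => fun _ => 1
  | [C] => hb C
  | C :: rest => fun x =>
      vapp (vconj (L C)) (hTrev L hb rest) x + hTrev L hb rest x * hb C x

/-- Auxiliary: the iterated Levi function `h_{Ā₁…Ā_k D}`, with the index list given in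
*reverse* order `[A_k,…,A₁]`, defined by the recursion
`h_{Ās C̄ D} = L_C̄ h_{Ās D} + h_{Ās}·h_{C̄D}`. -/
noncomputable def hDrev {n : ℕ} (L : Fin n → VF (2 * n + 1))
    (lv : Fin n → Fin n → (Fin (2 * n + 1) → ℝ) → ℂ)
    (hb : Fin n → (Fin (2 * n + 1) → ℝ) → ℂ) :
    List (Fin n) → Fin n → (Fin (2 * n + 1) → ℝ) → ℂ
  | [], _ => fun _ => 0
  | [C], D => lv C D
  | C :: rest, D => fun x =>
      vapp (vconj (L C)) (hDrev L lv hb rest D) x + hTrev L hb rest x * lv C D x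

/-- The iterated Levi function `h_{Ā₁…Ā_k D}`, for `As = [A₁,…,A_k]`. -/
noncomputable def hIt {n : ℕ} (L : Fin n → VF (2 * n + 1))
    (lv : Fin n → Fin n → (Fin (2 * n + 1) → ℝ) → ℂ)
    (hb : Fin n → (Fin (2 * n + 1) → ℝ) → ℂ)
    (As : List (Fin n)) (D : Fin n) : (Fin (2 * n + 1) → ℝ) → ℂ :=
  hDrev L lv hb As.reverse D

/-- The iterated Levi function `h_{Ā₁…Ā_k}`, for `As = [A₁,…,A_k]`. -/
noncomputable def hTIt {n : ℕ} (L : Fin n → VF (2 * n + 1))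
    (hb : Fin n → (Fin (2 * n + 1) → ℝ) → ℂ)
    (As : List (Fin n)) : (Fin (2 * n + 1) → ℝ) → ℂ :=
  hTrev L hb As.reverse

/-- The data of a CR diffeomorphism `f : Ω → Ω̂` expressed in two normalized frames
(Context 10/11/12): `Df·L_B = Σ γ^A_B L̂_A`, `Df·L_B̄ = Σ conj(γ^A_B) L̂_Ā`,
`Df·T = ξ T̂ + Σ η^A L̂_A + Σ conj(η^A) L̂_Ā`, with `(γ^A_B)` pointwise invertible,
`ξ` real valued, and `f` a smooth diffeomorphism with `f(0) = 0`. -/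
structure CRTrans (n : ℕ) (Ω Ωh : Set (Fin (2 * n + 1) → ℝ))
    (T : VF (2 * n + 1)) (L : Fin n → VF (2 * n + 1))
    (Th : VF (2 * n + 1)) (Lh : Fin n → VF (2 * n + 1))
    (f : (Fin (2 * n + 1) → ℝ) → (Fin (2 * n + 1) → ℝ))
    (γ : Fin n → Fin n → (Fin (2 * n + 1) → ℝ) → ℂ)
    (η : Fin n → (Fin (2 * n + 1) → ℝ) → ℂ)
    (ξ : (Fin (2 * n + 1) → ℝ) → ℝ) : Prop where
  smooth_f : ContDiffOn ℝ (⊤ : ℕ∞) f Ω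
  maps : Set.MapsTo f Ω Ωh
  f0 : f 0 = 0
  diffeo : ∃ g, ContDiffOn ℝ (⊤ : ℕ∞) g Ωh ∧ Set.MapsTo g Ωh Ω ∧
    (∀ x ∈ Ω, g (f x) = x) ∧ ∀ y ∈ Ωh, f (g y) = y
  smooth_γ : ∀ A B, ContDiffOn ℝ (⊤ : ℕ∞) (γ A B) Ω
  smooth_η : ∀ A, ContDiffOn ℝ (⊤ : ℕ∞) (η A) Ω
  smooth_ξ : ContDiffOn ℝ (⊤ : ℕ∞) ξ Ω
  γ_inv : ∀ x ∈ Ω, IsUnit (Matrix.of fun A B => γ A B x)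
  pushL : ∀ B, ∀ x ∈ Ω, ∀ j, vapp (L B) (fun y => ((f y j : ℝ) : ℂ)) x =
    ∑ A, γ A B x * Lh A (f x) j
  pushLb : ∀ B, ∀ x ∈ Ω, ∀ j, vapp (vconj (L B)) (fun y => ((f y j : ℝ) : ℂ)) x =
    ∑ A, (starRingEnd ℂ) (γ A B x) * vconj (Lh A) (f x) j
  pushT : ∀ x ∈ Ω, ∀ j, vapp T (fun y => ((f y j : ℝ) : ℂ)) x =
    (ξ x : ℂ) * Th (f x) j + (∑ A, η A x * Lh A (f x) j)
      + ∑ A, (starRingEnd ℂ) (η A x) * vconj (Lh A) (f x) j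


lemma vapp_congr {m : ℕ} (X : VF m) {u v : (Fin m → ℝ) → ℂ} {x : Fin m → ℝ}
    {Ω : Set (Fin m → ℝ)} (hΩ : IsOpen Ω) (hx : x ∈ Ω) (h : ∀ y ∈ Ω, u y = v y) :
    vapp X u x = vapp X v x := by
  have : u =ᶠ[𝓝 x] v := Filter.eventuallyEq_of_mem (hΩ.mem_nhds hx) h
  unfold vapp
  rw [this.fderiv_eq]

lemma vapp_mul {m : ℕ} (X : VF m) {u v : (Fin m → ℝ) → ℂ} {x : Fin m → ℝ}
    (hu : DifferentiableAt ℝ u x) (hv : DifferentiableAt ℝ v x) :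
    vapp X (fun y => u y * v y) x = vapp X u x * v x + u x * vapp X v x := by
  unfold vapp
  rw [fderiv_fun_mul hu hv, Finset.sum_mul, Finset.mul_sum, ← Finset.sum_add_distrib]
  refine Finset.sum_congr rfl fun i _ => ?_
  simp
  ring

lemma vapp_sum {m : ℕ} {ι : Type*} [Fintype ι] (X : VF m) {u : ι → (Fin m → ℝ) → ℂ}
    {x : Fin m → ℝ} (hu : ∀ i, DifferentiableAt ℝ (u i) x) :
    vapp X (fun y => ∑ i, u i y) x = ∑ i, vapp X (u i) x := by
  unfold vapp
  rw [fderiv_fun_sum (fun i _ => hu i), Finset.sum_comm]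
  refine Finset.sum_congr rfl fun i _ => ?_
  simp [Finset.mul_sum]

lemma vapp_conj {m : ℕ} (X : VF m) {u : (Fin m → ℝ) → ℂ} {x : Fin m → ℝ}
    (hu : DifferentiableAt ℝ u x) :
    vapp (vconj X) (fun y => (starRingEnd ℂ) (u y)) x = (starRingEnd ℂ) (vapp X u x) := by
  have h : HasFDerivAt (fun y => (starRingEnd ℂ) (u y))
      ((Complex.conjCLE : ℂ →L[ℝ] ℂ).comp (fderiv ℝ u x)) x := by
    have := ((Complex.conjCLE : ℂ →L[ℝ] ℂ).hasFDerivAt (x := u x)).comp x hu.hasFDerivAt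
    exact this
  unfold vapp vconj
  rw [h.fderiv, map_sum]
  refine Finset.sum_congr rfl fun i _ => ?_
  simp

lemma vapp_comp {m : ℕ} (X : VF m) {f : (Fin m → ℝ) → (Fin m → ℝ)} {w : (Fin m → ℝ) → ℂ}
    {x : Fin m → ℝ} (hf : DifferentiableAt ℝ f x) (hw : DifferentiableAt ℝ w (f x)) :
    vapp X (fun y => w (f y)) x =
      ∑ l, vapp X (fun y => ((f y l : ℝ) : ℂ)) x * fderiv ℝ w (f x) (Pi.single l 1) := by
  have h : HasFDerivAt (fun y => w (f y)) ((fderiv ℝ w (f x)).comp (fderiv ℝ f x)) x :=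
    hw.hasFDerivAt.comp x hf.hasFDerivAt
  have h2 : ∀ l, HasFDerivAt (fun y => ((f y l : ℝ) : ℂ))
      (Complex.ofRealCLM.comp ((ContinuousLinearMap.proj l).comp (fderiv ℝ f x))) x := by
    intro l
    have h3 : HasFDerivAt (fun y => f y l)
      ((ContinuousLinearMap.proj (R := ℝ) (φ := fun _ : Fin m => ℝ) l).comp (fderiv ℝ f x)) x :=
      hasFDerivAt_pi'.1 hf.hasFDerivAt l
    exact (Complex.ofRealCLM.hasFDerivAt (x := f x l)).comp x h3
  unfold vapp
  simp only [h.fderiv, (h2 _).fderiv]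
  simp only [Finset.sum_mul]
  rw [Finset.sum_comm]
  refine Finset.sum_congr rfl fun i _ => ?_
  have hv : ∀ v : Fin m → ℝ, fderiv ℝ w (f x) v
      = ∑ l, ((v l : ℝ) : ℂ) * fderiv ℝ w (f x) (Pi.single l 1) := by
    intro v
    conv_lhs => rw [← Finset.univ_sum_single v, map_sum]
    refine Finset.sum_congr rfl fun l _ => ?_
    have : (Pi.single l (v l) : Fin m → ℝ) = v l • Pi.single l 1 := by
      rw [← Pi.single_smul]; simp
    rw [this, map_smul, Complex.real_smul]
  rw [ContinuousLinearMap.comp_apply, hv, Finset.mul_sum]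
  refine Finset.sum_congr rfl fun l _ => ?_
  simp [mul_assoc]

lemma vapp_vbrk {m : ℕ} (X Y : VF m) {u : (Fin m → ℝ) → ℂ} {x : Fin m → ℝ}
    (hX : DifferentiableAt ℝ X x) (hY : DifferentiableAt ℝ Y x) (hu : ContDiffAt ℝ 2 u x) :
    vapp (vbrk X Y) u x = vapp X (fun y => vapp Y u y) x - vapp Y (fun y => vapp X u y) x := by
  have hd : DifferentiableAt ℝ (fderiv ℝ u) x :=
    (hu.fderiv_right (m := 1) (by norm_num)).differentiableAt (by norm_num)
  have hds : ∀ v, DifferentiableAt ℝ (fun y => fderiv ℝ u y v) x := fun v =>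
    hd.clm_apply (differentiableAt_const v)
  have hsym : IsSymmSndFDerivAt ℝ u x := hu.isSymmSndFDerivAt (by simp)
  have hval : ∀ v w, fderiv ℝ (fun y => fderiv ℝ u y v) x w = fderiv ℝ (fderiv ℝ u) x w v := by
    intro v w
    rw [fderiv_clm_apply hd (differentiableAt_const v)]
    simp
  have main : ∀ X Y : VF m, DifferentiableAt ℝ Y x → vapp X (fun y => vapp Y u y) x =
      ∑ i, vapp X (fun y => Y y i) x * fderiv ℝ u x (Pi.single i 1)
      + ∑ i, ∑ k, Y x i * X x k *
        fderiv ℝ (fderiv ℝ u) x (Pi.single k 1) (Pi.single i 1) := by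
    intro X Y hY
    have hYi : ∀ i, DifferentiableAt ℝ (fun y => Y y i) x := fun i =>
      differentiableAt_pi.1 hY i
    have : (fun y => vapp Y u y) =
      fun y => ∑ i, (fun i y => Y y i * fderiv ℝ u y (Pi.single i 1)) i y := rfl
    rw [this, vapp_sum X (u := fun i y => Y y i * fderiv ℝ u y (Pi.single i 1))
      (fun i => (hYi i).mul (hds _)), ← Finset.sum_add_distrib]
    refine Finset.sum_congr rfl fun i _ => ?_
    rw [vapp_mul X (hYi i) (hds _)]
    congr 1
    unfold vapp
    rw [Finset.mul_sum]
    refine Finset.sum_congr rfl fun k _ => ?_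
    rw [hval]; ring
  rw [main X Y hY, main Y X hX]
  have hc : ∑ i, ∑ k, Y x i * X x k *
        fderiv ℝ (fderiv ℝ u) x (Pi.single k 1) (Pi.single i 1)
      = ∑ i, ∑ k, X x i * Y x k *
        fderiv ℝ (fderiv ℝ u) x (Pi.single k 1) (Pi.single i 1) := by
    rw [Finset.sum_comm]
    refine Finset.sum_congr rfl fun i _ => Finset.sum_congr rfl fun k _ => ?_
    rw [hsym.eq (Pi.single i 1) (Pi.single k 1)]; ring
  rw [hc, add_sub_add_right_eq_sub, ← Finset.sum_sub_distrib]
  have hl : vapp (vbrk X Y) u x = ∑ i, (vapp X (fun y => Y y i) x - vapp Y (fun y => X y i) x)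
      * fderiv ℝ u x (Pi.single i 1) := rfl
  rw [hl]
  refine Finset.sum_congr rfl fun i _ => ?_
  ring

lemma key_bracket {m : ℕ} {ι : Type*} [Fintype ι] {Ω Ωh : Set (Fin m → ℝ)}
    (hΩ : IsOpen Ω) (hΩh : IsOpen Ωh) {f : (Fin m → ℝ) → (Fin m → ℝ)}
    (hf : ContDiffOn ℝ (⊤ : ℕ∞) f Ω) (hm : Set.MapsTo f Ω Ωh) {X Y : VF m}
    (hX : ∀ x ∈ Ω, DifferentiableAt ℝ X x) (hY : ∀ x ∈ Ω, DifferentiableAt ℝ Y x)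
    {E : ι → VF m} (hE : ∀ i, ∀ x ∈ Ωh, DifferentiableAt ℝ (E i) x)
    {a b : ι → (Fin m → ℝ) → ℂ}
    (ha : ∀ i, ∀ x ∈ Ω, DifferentiableAt ℝ (a i) x)
    (hb : ∀ i, ∀ x ∈ Ω, DifferentiableAt ℝ (b i) x)
    (pX : ∀ x ∈ Ω, ∀ j, vapp X (fun y => ((f y j : ℝ) : ℂ)) x = ∑ i, a i x * E i (f x) j)
    (pY : ∀ x ∈ Ω, ∀ j, vapp Y (fun y => ((f y j : ℝ) : ℂ)) x = ∑ i, b i x * E i (f x) j)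
    (x : Fin m → ℝ) (hx : x ∈ Ω) (j : Fin m) :
    vapp (vbrk X Y) (fun y => ((f y j : ℝ) : ℂ)) x =
      ∑ i, (vapp X (b i) x - vapp Y (a i) x) * E i (f x) j
      + ∑ k, ∑ i, a k x * b i x * vbrk (E k) (E i) (f x) j := by
  have hfx : ContDiffAt ℝ (⊤ : ℕ∞) f x := hf.contDiffAt (hΩ.mem_nhds hx)
  have hfd : DifferentiableAt ℝ f x := hfx.differentiableAt (by simp)
  have hu : ContDiffAt ℝ 2 (fun y => ((f y j : ℝ) : ℂ)) x := by
    have h1 : ContDiffAt ℝ 2 (fun y => f y j) x :=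
      contDiffAt_pi.1 (hfx.of_le (WithTop.coe_le_coe.2 (le_top : (2 : ℕ∞) ≤ ⊤))) j
    exact Complex.ofRealCLM.contDiff.contDiffAt.comp x h1
  have hEj : ∀ i, DifferentiableAt ℝ (fun y => E i y j) (f x) := fun i =>
    differentiableAt_pi.1 (hE i _ (hm hx)) j
  have hEf : ∀ i, DifferentiableAt ℝ (fun y => E i (f y) j) x := fun i =>
    (hEj i).comp x hfd
  have main : ∀ (X Y : VF m) (a b : ι → (Fin m → ℝ) → ℂ),
      (∀ i, ∀ x ∈ Ω, DifferentiableAt ℝ (b i) x) →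
      (∀ x ∈ Ω, ∀ j, vapp X (fun y => ((f y j : ℝ) : ℂ)) x = ∑ i, a i x * E i (f x) j) →
      (∀ x ∈ Ω, ∀ j, vapp Y (fun y => ((f y j : ℝ) : ℂ)) x = ∑ i, b i x * E i (f x) j) →
      vapp X (fun y => vapp Y (fun y => ((f y j : ℝ) : ℂ)) y) x =
        ∑ i, vapp X (b i) x * E i (f x) j
        + ∑ k, ∑ i, a k x * b i x * vapp (E k) (fun y => E i y j) (f x) := by
    intro X Y a b hb pX pY
    rw [vapp_congr X hΩ hx (fun y hy => pY y hy j),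
      vapp_sum X (u := fun i y => b i y * E i (f y) j) (fun i => (hb i x hx).mul (hEf i)),
      Finset.sum_comm, ← Finset.sum_add_distrib]
    refine Finset.sum_congr rfl fun i _ => ?_
    rw [vapp_mul X (hb i x hx) (hEf i), vapp_comp X (w := fun y => E i y j) hfd (hEj i)]
    congr 1
    simp only [pX x hx]
    unfold vapp
    simp only [Finset.mul_sum, Finset.sum_mul]
    rw [Finset.sum_comm]
    refine Finset.sum_congr rfl fun k _ => Finset.sum_congr rfl fun l _ => ?_
    ring
  rw [vapp_vbrk X Y (hX x hx) (hY x hx) hu, main X Y a b hb pX pY, main Y X b a ha pY pX]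
  have hc : ∑ k, ∑ i, b k x * a i x * vapp (E k) (fun y => E i y j) (f x)
      = ∑ k, ∑ i, a k x * b i x * vapp (E i) (fun y => E k y j) (f x) := by
    rw [Finset.sum_comm]
    refine Finset.sum_congr rfl fun i _ => Finset.sum_congr rfl fun k _ => ?_
    ring
  rw [hc, add_sub_add_comm, ← Finset.sum_sub_distrib, ← Finset.sum_sub_distrib]
  congr 1
  · refine Finset.sum_congr rfl fun i _ => ?_
    ring
  · refine Finset.sum_congr rfl fun i _ => ?_
    rw [← Finset.sum_sub_distrib]
    refine Finset.sum_congr rfl fun k _ => ?_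
    unfold vbrk
    ring

lemma frame_zero {n m : ℕ} {t : Fin m → ℂ} {l lb : Fin n → Fin m → ℂ}
    (h : LinearIndependent ℂ (Sum.elim (fun _ : Fin 1 => t) (Sum.elim l lb)))
    (α : ℂ) (β δ : Fin n → ℂ)
    (h0 : ∀ j, α * t j + ∑ A, β A * l A j + ∑ A, δ A * lb A j = 0) :
    α = 0 ∧ (∀ A, β A = 0) ∧ ∀ A, δ A = 0 := by
  rw [Fintype.linearIndependent_iff] at h
  have := h (Sum.elim (fun _ => α) (Sum.elim β δ)) (by
    ext j
    have := h0 j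
    simp [Fintype.sum_sum_type, ← add_assoc] at this ⊢
    exact this)
  exact ⟨this (Sum.inl 0), fun A => this (Sum.inr (Sum.inl A)),
    fun A => this (Sum.inr (Sum.inr A))⟩

lemma vapp_zero_fun {m : ℕ} (X : VF m) (x : Fin m → ℝ) : vapp X (fun _ => (0 : ℂ)) x = 0 := by
  simp [vapp]

lemma vapp_smul_of {m : ℕ} {Z T : VF m} {x : Fin m → ℝ} {c : ℂ} (h : Z x = fun i => c * T x i)
    (u : (Fin m → ℝ) → ℂ) : vapp Z u x = c * vapp T u x := by
  simp [vapp, h, Finset.mul_sum, mul_assoc]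

lemma vbrk_conj {m : ℕ} {X Y : VF m} {x : Fin m → ℝ}
    (hX : DifferentiableAt ℝ X x) (hY : DifferentiableAt ℝ Y x) :
    vbrk (vconj X) (vconj Y) x = vconj (vbrk X Y) x := by
  ext j
  have h1 := vapp_conj X (u := fun y => Y y j) (differentiableAt_pi.1 hY j)
  have h2 := vapp_conj Y (u := fun y => X y j) (differentiableAt_pi.1 hX j)
  simp only [vbrk, vconj, map_sub] at *
  rw [← h1, ← h2]

lemma conj_diff {E : Type*} [NormedAddCommGroup E] [NormedSpace ℝ E] {u : E → ℂ} {x : E}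
    (hu : DifferentiableAt ℝ u x) : DifferentiableAt ℝ (fun y => (starRingEnd ℂ) (u y)) x :=
  ((Complex.conjCLE : ℂ →L[ℝ] ℂ).differentiableAt (x := u x)).comp x hu

lemma vconj_diff {m : ℕ} {X : VF m} {x : Fin m → ℝ}
    (hX : DifferentiableAt ℝ X x) : DifferentiableAt ℝ (vconj X) x :=
  differentiableAt_pi.2 fun i => conj_diff (differentiableAt_pi.1 hX i)

/-- The basic identities (2.9)–(2.13) for a CR diffeomorphism expressed in
two normalized frames. -/
theorem statement10 (n : ℕ) (hn : 1 ≤ n)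
    (Ω Ωh : Set (Fin (2 * n + 1) → ℝ))
    (T : VF (2 * n + 1)) (L : Fin n → VF (2 * n + 1))
    (lv : Fin n → Fin n → (Fin (2 * n + 1) → ℝ) → ℂ)
    (hb : Fin n → (Fin (2 * n + 1) → ℝ) → ℂ)
    (Th : VF (2 * n + 1)) (Lh : Fin n → VF (2 * n + 1))
    (lvh : Fin n → Fin n → (Fin (2 * n + 1) → ℝ) → ℂ)
    (hbh : Fin n → (Fin (2 * n + 1) → ℝ) → ℂ)
    (hF : NFrame n Ω T L lv hb) (hFh : NFrame n Ωh Th Lh lvh hbh)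
    (f : (Fin (2 * n + 1) → ℝ) → (Fin (2 * n + 1) → ℝ))
    (γ : Fin n → Fin n → (Fin (2 * n + 1) → ℝ) → ℂ)
    (η : Fin n → (Fin (2 * n + 1) → ℝ) → ℂ)
    (ξ : (Fin (2 * n + 1) → ℝ) → ℝ)
    (htr : CRTrans n Ω Ωh T L Th Lh f γ η ξ) :
    ∀ x ∈ Ω,
      (∀ A B, (ξ x : ℂ) * lv A B x =
        ∑ C, ∑ D, γ D B x * (starRingEnd ℂ) (γ C A x) * lvh C D (f x)) ∧
      (∀ A B E, vapp (vconj (L A)) (γ E B) x + η E x * lv A B x = 0) ∧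
      (∀ A, vapp (vconj (L A)) (fun y => ((ξ y : ℝ) : ℂ)) x + (ξ x : ℂ) * hb A x =
        (ξ x : ℂ) * (∑ C, (starRingEnd ℂ) (γ C A x) * hbh C (f x))
          + ∑ C, ∑ D, (starRingEnd ℂ) (γ C A x) * η D x * lvh C D (f x)) ∧
      (∀ A C, vapp (vconj (L A)) (η C) x + η C x * hb A x = 0) ∧
      (∀ A C, vapp T (γ C A) x - vapp (L A) (η C) x
        - η C x * (starRingEnd ℂ) (hb A x) = 0) := by
  have oΩ := hF.open_Ω
  have oΩh := hFh.open_Ω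
  have dd : ∀ {G : Type} [NormedAddCommGroup G] [NormedSpace ℝ G]
      {S : Set (Fin (2 * n + 1) → ℝ)} {u : (Fin (2 * n + 1) → ℝ) → G},
      IsOpen S → ContDiffOn ℝ (⊤ : ℕ∞) u S → ∀ x ∈ S, DifferentiableAt ℝ u x := by
    intro G _ _ S u hS hu x hx
    exact (hu.contDiffAt (hS.mem_nhds hx)).differentiableAt (by simp)
  have dL : ∀ A, ∀ x ∈ Ω, DifferentiableAt ℝ (L A) x := fun A => dd oΩ (hF.smoothL A)
  have dT : ∀ x ∈ Ω, DifferentiableAt ℝ T x := dd oΩ hF.smoothT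
  have dLh : ∀ A, ∀ x ∈ Ωh, DifferentiableAt ℝ (Lh A) x := fun A => dd oΩh (hFh.smoothL A)
  have dTh : ∀ x ∈ Ωh, DifferentiableAt ℝ Th x := dd oΩh hFh.smoothT
  have dγ : ∀ A B, ∀ x ∈ Ω, DifferentiableAt ℝ (γ A B) x := fun A B => dd oΩ (htr.smooth_γ A B)
  have dη : ∀ A, ∀ x ∈ Ω, DifferentiableAt ℝ (η A) x := fun A => dd oΩ (htr.smooth_η A)
  have dξ : ∀ x ∈ Ω, DifferentiableAt ℝ (fun y => ((ξ y : ℝ) : ℂ)) x := fun x hx =>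
    (Complex.ofRealCLM.differentiableAt (x := ξ x)).comp x (dd oΩ htr.smooth_ξ x hx)
  set E : Fin 1 ⊕ (Fin n ⊕ Fin n) → VF (2 * n + 1) :=
    Sum.elim (fun _ => Th) (Sum.elim Lh (fun A => vconj (Lh A))) with hEdef
  have dE : ∀ i, ∀ x ∈ Ωh, DifferentiableAt ℝ (E i) x := by
    rintro (i | i | i) x hx
    · exact dTh x hx
    · exact dLh i x hx
    · exact vconj_diff (dLh i x hx)
  -- coefficient families
  set bL : Fin n → Fin 1 ⊕ (Fin n ⊕ Fin n) → (Fin (2 * n + 1) → ℝ) → ℂ := fun B =>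
    Sum.elim (fun _ _ => 0) (Sum.elim (fun C => γ C B) (fun _ _ => 0)) with hbL
  set bLb : Fin n → Fin 1 ⊕ (Fin n ⊕ Fin n) → (Fin (2 * n + 1) → ℝ) → ℂ := fun B =>
    Sum.elim (fun _ _ => 0) (Sum.elim (fun _ _ => 0)
      (fun C y => (starRingEnd ℂ) (γ C B y))) with hbLb
  set bT : Fin 1 ⊕ (Fin n ⊕ Fin n) → (Fin (2 * n + 1) → ℝ) → ℂ :=
    Sum.elim (fun _ y => ((ξ y : ℝ) : ℂ)) (Sum.elim η
      (fun C y => (starRingEnd ℂ) (η C y))) with hbT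
  have dbL : ∀ B i, ∀ x ∈ Ω, DifferentiableAt ℝ (bL B i) x := by
    rintro B (i | i | i) x hx
    · exact differentiableAt_const _
    · exact dγ i B x hx
    · exact differentiableAt_const _
  have dbLb : ∀ B i, ∀ x ∈ Ω, DifferentiableAt ℝ (bLb B i) x := by
    rintro B (i | i | i) x hx
    · exact differentiableAt_const _
    · exact differentiableAt_const _
    · exact conj_diff (dγ i B x hx)
  have dbT : ∀ i, ∀ x ∈ Ω, DifferentiableAt ℝ (bT i) x := by
    rintro (i | i | i) x hx
    · exact dξ x hx
    · exact dη i x hx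
    · exact conj_diff (dη i x hx)
  have pL : ∀ B, ∀ x ∈ Ω, ∀ j, vapp (L B) (fun y => ((f y j : ℝ) : ℂ)) x =
      ∑ i, bL B i x * E i (f x) j := by
    intro B x hx j
    rw [htr.pushL B x hx j]
    simp [hbL, hEdef, Fintype.sum_sum_type]
  have pLb : ∀ B, ∀ x ∈ Ω, ∀ j, vapp (vconj (L B)) (fun y => ((f y j : ℝ) : ℂ)) x =
      ∑ i, bLb B i x * E i (f x) j := by
    intro B x hx j
    rw [htr.pushLb B x hx j]
    simp [hbLb, hEdef, Fintype.sum_sum_type]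
  have pT : ∀ x ∈ Ω, ∀ j, vapp T (fun y => ((f y j : ℝ) : ℂ)) x =
      ∑ i, bT i x * E i (f x) j := by
    intro x hx j
    rw [htr.pushT x hx j]
    simp [hbT, hEdef, Fintype.sum_sum_type, add_assoc]
  intro x hx
  have hfx := htr.maps hx
  have cLbLb : ∀ A B j, vbrk (vconj (Lh A)) (vconj (Lh B)) (f x) j = 0 := by
    intro A B j
    rw [vbrk_conj (dLh A _ hfx) (dLh B _ hfx)]
    simp [vconj, hFh.commLL A B _ hfx]
  have cLbL : ∀ A B j, vbrk (vconj (Lh A)) (Lh B) (f x) j = -(lvh A B (f x)) * Th (f x) j :=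
    fun A B j => congrFun (hFh.commLbL A B _ hfx) j
  have cLbT : ∀ A j, vbrk (vconj (Lh A)) Th (f x) j = -(hbh A (f x)) * Th (f x) j :=
    fun A j => congrFun (hFh.commLbT A _ hfx) j
  have R1 : ∀ A B, _ := fun A B => frame_zero (hFh.indep _ hfx)
    ((ξ x : ℂ) * lv A B x - ∑ C, ∑ D, γ D B x * (starRingEnd ℂ) (γ C A x) * lvh C D (f x))
    (fun E => vapp (vconj (L A)) (γ E B) x + η E x * lv A B x)
    (fun E => - vapp (L B) (fun y => (starRingEnd ℂ) (γ E A y)) x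
      + (starRingEnd ℂ) (η E x) * lv A B x) (by
      intro j
      have k := key_bracket oΩ oΩh htr.smooth_f htr.maps
        (fun x hx => vconj_diff (dL A x hx)) (dL B) dE (dbLb A) (dbL B) (pLb A) (pL B) x hx j
      rw [vapp_smul_of (hF.commLbL A B x hx), htr.pushT x hx j] at k
      simp [hbL, hbLb, hEdef, Fintype.sum_sum_type, vapp_zero_fun, cLbL] at k
      simp only [sub_mul, add_mul, neg_mul, Finset.sum_add_distrib, Finset.sum_neg_distrib,
        mul_add, Finset.sum_mul, Finset.mul_sum] at k ⊢
      have e1 : ∀ C D, γ D B x * (starRingEnd ℂ) (γ C A x) * lvh C D (f x) * Th (f x) j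
        = (starRingEnd ℂ) (γ C A x) * γ D B x * (lvh C D (f x) * Th (f x) j) := by
        intros; ring
      have e2 : ∀ C, η C x * lv A B x * Lh C (f x) j = lv A B x * (η C x * Lh C (f x) j) := by
        intros; ring
      have e3 : ∀ C, (starRingEnd ℂ) (η C x) * lv A B x * vconj (Lh C) (f x) j
        = lv A B x * ((starRingEnd ℂ) (η C x) * vconj (Lh C) (f x) j) := by
        intros; ring
      simp only [e1, e2, e3]
      linear_combination -k)
  have R2 : ∀ A, _ := fun A => frame_zero (hFh.indep _ hfx)
    (vapp (vconj (L A)) (fun y => ((ξ y : ℝ) : ℂ)) x + (ξ x : ℂ) * hb A x -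
        ((ξ x : ℂ) * (∑ C, (starRingEnd ℂ) (γ C A x) * hbh C (f x))
          + ∑ C, ∑ D, (starRingEnd ℂ) (γ C A x) * η D x * lvh C D (f x)))
    (fun C => vapp (vconj (L A)) (η C) x + η C x * hb A x)
    (fun C => vapp (vconj (L A)) (fun y => (starRingEnd ℂ) (η C y)) x
      - vapp T (fun y => (starRingEnd ℂ) (γ C A y)) x
      + (starRingEnd ℂ) (η C x) * hb A x) (by
      intro j
      have k := key_bracket oΩ oΩh htr.smooth_f htr.maps
        (fun x hx => vconj_diff (dL A x hx)) dT dE (dbLb A) dbT (pLb A) pT x hx j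
      rw [vapp_smul_of (hF.commLbT A x hx), htr.pushT x hx j] at k
      simp [hbT, hbLb, hEdef, Fintype.sum_sum_type, vapp_zero_fun, cLbL, cLbT, cLbLb] at k
      simp only [sub_mul, add_mul, neg_mul, Finset.sum_add_distrib, Finset.sum_neg_distrib,
        Finset.sum_sub_distrib, mul_add, Finset.sum_mul, Finset.mul_sum] at k ⊢
      have e1 : ∀ C D, (starRingEnd ℂ) (γ C A x) * η D x * lvh C D (f x) * Th (f x) j
        = (starRingEnd ℂ) (γ C A x) * η D x * (lvh C D (f x) * Th (f x) j) := by
        intros; ring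
      have e2 : ∀ C, η C x * hb A x * Lh C (f x) j = hb A x * (η C x * Lh C (f x) j) := by
        intros; ring
      have e3 : ∀ C, (starRingEnd ℂ) (η C x) * hb A x * vconj (Lh C) (f x) j
        = hb A x * ((starRingEnd ℂ) (η C x) * vconj (Lh C) (f x) j) := by
        intros; ring
      have e4 : ∀ C, (ξ x : ℂ) * ((starRingEnd ℂ) (γ C A x) * hbh C (f x)) * Th (f x) j
        = (starRingEnd ℂ) (γ C A x) * (ξ x : ℂ) * (hbh C (f x) * Th (f x) j) := by
        intros; ring
      simp only [e1, e2, e3, e4]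
      linear_combination -k)
  have hTc : vconj T = T := by
    ext y i
    exact hF.Treal y i
  refine ⟨fun A B => sub_eq_zero.1 (R1 A B).1, fun A B => (R1 A B).2.1,
    fun A => sub_eq_zero.1 (R2 A).1, fun A => (R2 A).2.1, fun A C => ?_⟩
  have h := (R2 A).2.2 C
  rw [vapp_conj (L A) (dη C x hx)] at h
  have h2 := vapp_conj T (dγ C A x hx)
  rw [hTc] at h2
  rw [h2] at h
  have h3 := congrArg (starRingEnd ℂ) h
  simp only [map_add, map_sub, map_mul, map_zero, Complex.conj_conj] at h3
  linear_combination -h3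
end
end

section
/- Define smooth functions a_{E,F̄₁…F̄_s} on Ω by [⋯[[L_E, L_F̄₁], L_F̄₂] ⋯, L_F̄_s] = a_{E,F̄₁…F̄_s}·T (these iterated commutators are smooth multiples of T as a consequence of the commutation relations), and assume there is an integer ℓ₀ ≥ 1 such that a_{E,F̄₁…F̄_s}(0) = 0 for all indices whenever s < ℓ₀, while a_{1,F̄₁…F̄_{ℓ₀}}(0) ≠ 0 for some F₁, …, F_{ℓ₀} ∈ {1,…,n}. Then for every multi-index J ∈ {1,…,n}^t (t ≥ 0) and every integer k ≥ 1, setting m to range over 1, …, |J|+k, there exist smooth functions a^{E₁…E_m F̄₁…F̄_s} on a neighborhood of 0 in Ω such that, as differential operators acting on smooth ℂ-valued functions near 0, Σ_{m=1}^{|J|+k} Σ_{s=0}^{m·ℓ₀} Σ_{E₁,…,E_m, F₁,…,F_s ∈ {1,…,n}} a^{E₁…E_m F̄₁…F̄_s} · [⋯[[L_{E₁} ∘ ⋯ ∘ L_{E_m}, L_F̄₁], L_F̄₂] ⋯, L_F̄_s] = L^J ∘ T^k, where L^J := L_{J₁} ∘ ⋯ ∘ L_{J_t}, T^k is the k-fold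 composition of T, and the brackets are commutators of differential operators. -/
open scoped Topology

noncomputable section

/-- The composition `L^J = L_{J₁} ∘ ⋯ ∘ L_{J_t}` applied to a function, for `J = [J₁,…,J_t]`. -/
noncomputable def appOp {n : ℕ} (L : Fin n → VF (2 * n + 1)) (J : List (Fin n))
    (u : (Fin (2 * n + 1) → ℝ) → ℂ) : (Fin (2 * n + 1) → ℝ) → ℂ :=
  J.foldr (fun j v => vapp (L j) v) u

/-- Differential operators on functions on `ℝ^m`. -/
abbrev Op (m : ℕ) := ((Fin m → ℝ) → ℂ) → (Fin m → ℝ) → ℂ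

/-- Commutator of operators. -/
noncomputable def ocomm {m : ℕ} (P Q : Op m) : Op m := fun u x => P (Q u) x - Q (P u) x

/-- The operator given by a vector field. -/
noncomputable def opOf {m : ℕ} (X : VF m) : Op m := fun u => vapp X u

/-- Iterated operator commutator `[⋯[[P, L_F̄₁], L_F̄₂]⋯, L_F̄_s]` for `Fs = [F₁,…,F_s]`. -/
noncomputable def opItcBar {n : ℕ} (L : Fin n → VF (2 * n + 1)) (P : Op (2 * n + 1))
    (Fs : List (Fin n)) : Op (2 * n + 1) :=
  Fs.foldl (fun Q F => ocomm Q (opOf (vconj (L F)))) P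

/-- Iterated vector-field commutator `[⋯[[X, L_F̄₁], L_F̄₂]⋯, L_F̄_s]`. -/
noncomputable def vItcBar {n : ℕ} (L : Fin n → VF (2 * n + 1)) (X : VF (2 * n + 1))
    (Fs : List (Fin n)) : VF (2 * n + 1) :=
  Fs.foldl (fun Z F => vbrk Z (vconj (L F))) X

section
namespace P14
variable {S ι : Type} [CommRing S] [Algebra ℂ S]

abbrev IsDer (X : Module.End ℂ S) : Prop := ∀ f g : S, X (f * g) = f * X g + X f * g

lemma IsDer.mul_smul {X : Module.End ℂ S} (hX : IsDer X) (f : S) (P : Module.End ℂ S) :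
    X * (f • P) = f • (X * P) + (X f) • P := by
  ext u
  simp [hX f (P u)]

def Lw (L : ι → Module.End ℂ S) (J : List ι) : Module.End ℂ S := (J.map L).prod

@[simp] lemma Lw_nil (L : ι → Module.End ℂ S) : Lw L [] = 1 := by simp [Lw]
@[simp] lemma Lw_cons (L : ι → Module.End ℂ S) (a : ι) (J : List ι) :
    Lw L (a :: J) = L a * Lw L J := by simp [Lw]

def Gs (L : ι → Module.End ℂ S) (T : Module.End ℂ S) (N : ℕ) : Set (Module.End ℂ S) :=
  {P | ∃ (J : List ι) (j : ℕ), 1 ≤ J.length + j ∧ J.length + j ≤ N ∧ P = Lw L J * T ^ j}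

def Gm (L : ι → Module.End ℂ S) (T : Module.End ℂ S) (N : ℕ) : Submodule S (Module.End ℂ S) :=
  Submodule.span S (Gs L T N)

lemma Gm_mono (L : ι → Module.End ℂ S) (T : Module.End ℂ S) {N M : ℕ} (h : N ≤ M) :
    Gm L T N ≤ Gm L T M := by
  apply Submodule.span_mono
  rintro P ⟨J, j, h1, h2, h3⟩
  exact ⟨J, j, h1, h2.trans h, h3⟩

lemma Gm_zero (L : ι → Module.End ℂ S) (T : Module.End ℂ S) : Gm L T 0 = ⊥ := by
  rw [Gm, Submodule.span_eq_bot]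
  rintro P ⟨J, j, h1, h2, h3⟩
  omega

lemma Gm_fg [Finite ι] (L : ι → Module.End ℂ S) (T : Module.End ℂ S) (N : ℕ) :
    (Gm L T N).FG := by
  apply Submodule.fg_span
  have h : (({J : List ι | J.length ≤ N} ×ˢ Set.Iic N).image
      (fun p : List ι × ℕ => Lw L p.1 * T ^ p.2)).Finite :=
    ((List.finite_length_le ι N).prod (Set.finite_Iic N)).image _
  refine h.subset ?_
  rintro P ⟨J, j, h1, h2, rfl⟩
  exact ⟨(J, j), ⟨by simp; omega, by simp; omega⟩, rfl⟩

lemma mem_Gm (L : ι → Module.End ℂ S) (T : Module.End ℂ S) {N : ℕ} (J : List ι) (j : ℕ)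
    (h1 : 1 ≤ J.length + j) (h2 : J.length + j ≤ N) : Lw L J * T ^ j ∈ Gm L T N :=
  Submodule.subset_span ⟨J, j, h1, h2, rfl⟩

lemma der_span {X : Module.End ℂ S} (hX : IsDer X) {s : Set (Module.End ℂ S)}
    {M : Submodule S (Module.End ℂ S)} (h1 : ∀ w ∈ s, X * w ∈ M) (h2 : ∀ w ∈ s, w ∈ M)
    {P : Module.End ℂ S} (hP : P ∈ Submodule.span S s) : X * P ∈ M := by
  have : X * P ∈ M ∧ P ∈ M := by
    induction hP using Submodule.span_induction with
    | mem x h => exact ⟨h1 x h, h2 x h⟩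
    | zero => simp
    | add x y _ _ hx hy => exact ⟨by rw [mul_add]; exact M.add_mem hx.1 hy.1, M.add_mem hx.2 hy.2⟩
    | smul a x _ hx =>
      refine ⟨?_, M.smul_mem _ hx.2⟩
      rw [hX.mul_smul]
      exact M.add_mem (M.smul_mem _ hx.1) (M.smul_mem _ hx.2)
  exact this.1

variable {L : ι → Module.End ℂ S} {T : Module.End ℂ S}

lemma L_mul_G (hL : ∀ i, IsDer (L i)) (i : ι) {N : ℕ} {P} (hP : P ∈ Gm L T N) :
    L i * P ∈ Gm L T (N + 1) := by
  refine der_span (hL i) ?_ ?_ hP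
  · rintro w ⟨J, j, h1, h2, rfl⟩
    rw [← mul_assoc, ← Lw_cons]
    exact mem_Gm L T _ _ (by simp; omega) (by simp; omega)
  · rintro w ⟨J, j, h1, h2, rfl⟩
    exact mem_Gm L T _ _ h1 (by omega)

lemma T_comm (hL : ∀ i, IsDer (L i)) (hLT : ∀ i, ∃ c : S, L i * T - T * L i = c • T)
    (J : List ι) (j : ℕ) : T * (Lw L J * T ^ j) - Lw L J * T ^ (j + 1) ∈ Gm L T (J.length + j) := by
  induction J with
  | nil => simp [pow_succ']
  | cons a J ih =>
    obtain ⟨c, hc⟩ := hLT a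
    have e : T * (Lw L (a :: J) * T ^ j) - Lw L (a :: J) * T ^ (j + 1)
      = L a * (T * (Lw L J * T ^ j) - Lw L J * T ^ (j + 1))
        - c • ((T * (Lw L J * T ^ j) - Lw L J * T ^ (j + 1)) + Lw L J * T ^ (j + 1)) := by
      have : T * L a = L a * T - c • T := by rw [← hc]; abel
      rw [Lw_cons, mul_assoc (L a), ← mul_assoc T, this, sub_add_cancel, ← smul_mul_assoc,
        mul_sub, sub_mul, mul_assoc, mul_assoc]
      abel
    rw [e]
    have hle : (a :: J).length + j = J.length + j + 1 := by simp; omega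
    rw [hle]
    refine Submodule.sub_mem _ (L_mul_G hL a ih) (Submodule.smul_mem _ _ (Submodule.add_mem _ ?_ ?_))
    · exact Gm_mono L T (by omega) ih
    · exact mem_Gm L T _ _ (by omega) (by omega)

lemma T_mul_G (hL : ∀ i, IsDer (L i)) (hT : IsDer T)
    (hLT : ∀ i, ∃ c : S, L i * T - T * L i = c • T) {N : ℕ} {P} (hP : P ∈ Gm L T N) :
    T * P ∈ Gm L T (N + 1) := by
  refine der_span hT ?_ ?_ hP
  · rintro w ⟨J, j, h1, h2, rfl⟩
    rw [← sub_add_cancel (T * (Lw L J * T ^ j)) (Lw L J * T ^ (j + 1))]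
    refine Submodule.add_mem _ (Gm_mono L T (by omega) (T_comm hL hLT J j)) ?_
    exact mem_Gm L T _ _ (by omega) (by omega)
  · rintro w ⟨J, j, h1, h2, rfl⟩
    exact mem_Gm L T _ _ h1 (by omega)

/-- the filtration pieces -/
def Hm (L : ι → Module.End ℂ S) (T : Module.End ℂ S) (I : Ideal S) (N k : ℕ) :
    Submodule ℂ (Module.End ℂ S) :=
  Submodule.span ℂ {P | ∃ (J : List ι) (j : ℕ), J.length + j = N ∧ j < k ∧ P = Lw L J * T ^ j}
    ⊔ (I • Gm L T N ⊔ Gm L T (N - 1)).restrictScalars ℂ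

variable {I : Ideal S}

lemma Hm_mono {N k k' : ℕ} (h : k ≤ k') : Hm L T I N k ≤ Hm L T I N k' := by
  refine sup_le_sup_right (Submodule.span_mono ?_) _
  rintro P ⟨J, j, h1, h2, h3⟩
  exact ⟨J, j, h1, h2.trans_le h, h3⟩

lemma mem_Hm {N k : ℕ} (J : List ι) (j : ℕ) (h1 : J.length + j = N) (h2 : j < k) :
    Lw L J * T ^ j ∈ Hm L T I N k :=
  Submodule.mem_sup_left (Submodule.subset_span ⟨J, j, h1, h2, rfl⟩)

lemma G_le_Hm {N k : ℕ} {P} (h : P ∈ Gm L T (N - 1)) : P ∈ Hm L T I N k :=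
  Submodule.mem_sup_right (Submodule.mem_sup_right h : P ∈ I • Gm L T N ⊔ Gm L T (N - 1))

lemma IG_le_Hm {N k : ℕ} {P} (h : P ∈ I • Gm L T N) : P ∈ Hm L T I N k :=
  Submodule.mem_sup_right (Submodule.mem_sup_left h : P ∈ I • Gm L T N ⊔ Gm L T (N - 1))

lemma Hm_le {N k : ℕ} {K : Submodule S (Module.End ℂ S)}
    (h1 : ∀ (J : List ι) (j : ℕ), J.length + j = N → j < k → Lw L J * T ^ j ∈ K)
    (h2 : I • Gm L T N ≤ K) (h3 : Gm L T (N - 1) ≤ K) : Hm L T I N k ≤ K.restrictScalars ℂ := by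
  refine sup_le (Submodule.span_le.2 ?_) ?_
  · rintro P ⟨J, j, h1', h2', rfl⟩
    exact h1 J j h1' h2'
  · exact fun P hP => (sup_le h2 h3) hP

lemma Hm_le_G {N k : ℕ} {P} (h : P ∈ Hm L T I (N + 1) k) : P ∈ Gm L T (N + 1) := by
  refine Hm_le (K := Gm L T (N + 1)) ?_ Submodule.smul_le_right (Gm_mono L T (by omega)) h
  intro J j h1 h2
  exact mem_Gm L T _ _ (by omega) (by omega)

lemma mul_Hm {X : Module.End ℂ S} (hX : IsDer X)
    (hG : ∀ N P, P ∈ Gm L T N → X * P ∈ Gm L T (N + 1)) {N k k' : ℕ}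
    (hg : ∀ (J : List ι) (j : ℕ), J.length + j = N → j < k →
      X * (Lw L J * T ^ j) ∈ Hm L T I (N + 1) k')
    {P} (hP : P ∈ Hm L T I N k) : X * P ∈ Hm L T I (N + 1) k' := by
  have hGN : ∀ P ∈ Gm L T (N - 1), X * P ∈ Hm L T I (N + 1) k' := by
    intro P hP
    rcases N with _ | N
    · simp only [Nat.zero_sub, Gm_zero, Submodule.mem_bot] at hP
      simp [hP]
    · exact G_le_Hm (hG _ _ hP)
  obtain ⟨P1, h1, P2, h2, rfl⟩ := Submodule.mem_sup.1 hP
  obtain ⟨P3, h3, P4, h4, rfl⟩ := Submodule.mem_sup.1 h2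
  rw [mul_add, mul_add]
  refine Submodule.add_mem _ ?_ (Submodule.add_mem _ ?_ (hGN _ h4))
  · clear hP
    induction h1 using Submodule.span_induction with
    | mem x h => obtain ⟨J, j, a, b, rfl⟩ := h; exact hg J j a b
    | zero => simp
    | add x y _ _ hx hy => rw [mul_add]; exact Submodule.add_mem _ hx hy
    | smul a x hxs hx =>
      rw [mul_smul_comm]
      exact Submodule.smul_mem _ _ hx
  · clear hP h2
    induction h3 using Submodule.smul_induction_on' with
    | smul r hr w hw =>
      rw [hX.mul_smul]
      refine Submodule.add_mem _ (IG_le_Hm (Submodule.smul_mem_smul hr (hG _ _ hw))) (G_le_Hm ?_)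
      exact Submodule.smul_mem _ _ hw
    | add x _ y _ hx hy => rw [mul_add]; exact Submodule.add_mem _ hx hy

lemma L_mul_Hm (hL : ∀ i, IsDer (L i)) (i : ι) {N k : ℕ} {P} (hP : P ∈ Hm L T I N k) :
    L i * P ∈ Hm L T I (N + 1) k := by
  refine mul_Hm (hL i) (fun N P h => L_mul_G hL i h) ?_ hP
  intro J j h1 h2
  rw [← mul_assoc, ← Lw_cons]
  exact mem_Hm _ _ (by simp; omega) h2

lemma T_mul_Hm (hL : ∀ i, IsDer (L i)) (hT : IsDer T)
    (hLT : ∀ i, ∃ c : S, L i * T - T * L i = c • T) {N k : ℕ} {P} (hP : P ∈ Hm L T I N k) :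
    T * P ∈ Hm L T I (N + 1) (k + 1) := by
  refine mul_Hm hT (fun N P h => T_mul_G hL hT hLT h) ?_ hP
  intro J j h1 h2
  rw [← sub_add_cancel (T * (Lw L J * T ^ j)) (Lw L J * T ^ (j + 1))]
  refine Submodule.add_mem _ (G_le_Hm ?_) (mem_Hm _ _ (by omega) (by omega))
  have := T_comm hL hLT J j
  rw [h1] at this
  exact this

/-- Leibniz -/
lemma leib (δ : Module.End ℂ S →ₗ[ℂ] Module.End ℂ S)
    (hδ : ∀ P Q, δ (P * Q) = P * δ Q + δ P * Q) (s : ℕ) (P Q : Module.End ℂ S) :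
    (δ ^ s) (P * Q) = ∑ ij ∈ Finset.HasAntidiagonal.antidiagonal s,
      s.choose ij.1 • ((δ ^ ij.1) P * (δ ^ ij.2) Q) := by
  induction s with
  | zero => simp
  | succ s ih =>
    rw [Finset.sum_antidiagonal_choose_succ_nsmul (fun i j => (δ ^ i) P * (δ ^ j) Q) s]
    rw [pow_succ', Module.End.mul_apply, ih, map_sum, ← Finset.sum_add_distrib]
    refine Finset.sum_congr rfl ?_
    rintro ⟨i, j⟩ hij
    rw [Finset.HasAntidiagonal.mem_antidiagonal] at hij
    simp only [map_nsmul, hδ, pow_succ', Module.End.mul_apply, nsmul_add]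
    rw [Nat.choose_symm_of_eq_add hij.symm]

lemma leib' (δ : Module.End ℂ S →ₗ[ℂ] Module.End ℂ S)
    (hδ : ∀ P Q, δ (P * Q) = P * δ Q + δ P * Q) (s : ℕ) (P Q : Module.End ℂ S) :
    (δ ^ s) (P * Q) = ∑ r ∈ Finset.range (s + 1),
      s.choose r • ((δ ^ r) P * (δ ^ (s - r)) Q) := by
  rw [leib δ hδ, Finset.Nat.sum_antidiagonal_eq_sum_range_succ_mk]

/-- elementary symmetric-type elements -/
def ep (L : ι → Module.End ℂ S) (β : ι → ℂ) (E : List ι) : Polynomial (Module.End ℂ S) :=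
  (E.map (fun a => Polynomial.C (L a) + Polynomial.X * Polynomial.C (algebraMap ℂ _ (β a)))).prod

def ee (L : ι → Module.End ℂ S) (β : ι → ℂ) (E : List ι) (k : ℕ) : Module.End ℂ S :=
  (ep L β E).coeff k

variable {β : ι → ℂ}

lemma ee_nil_succ (k : ℕ) : ee L β [] (k + 1) = 0 := by
  simp [ee, ep, Polynomial.coeff_one]

lemma ee_cons_succ (a : ι) (E : List ι) (k : ℕ) :
    ee L β (a :: E) (k + 1) = L a * ee L β E (k + 1) + β a • ee L β E k := by
  simp [ee, ep, add_mul, mul_assoc, Polynomial.coeff_X_mul, Algebra.smul_def]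

lemma ee_zero (E : List ι) : ee L β E 0 = Lw L E := by
  induction E with
  | nil => simp [ee, ep]
  | cons a E ih =>
    rw [Lw_cons, ← ih]
    simp [ee, ep, mul_assoc, Polynomial.mul_coeff_zero]

lemma ee_append (E E' : List ι) (k : ℕ) : ee L β (E ++ E') k =
    ∑ p ∈ Finset.HasAntidiagonal.antidiagonal k, ee L β E p.1 * ee L β E' p.2 := by
  simp only [ee, ep, List.map_append, List.prod_append, Polynomial.coeff_mul]

lemma ee_replicate (a : ι) (m l : ℕ) : ee L β (List.replicate m a) l =
    ((m.choose l : ℂ) * β a ^ l) • L a ^ (m - l) := by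
  induction m generalizing l with
  | zero =>
    cases l with
    | zero => simp [ee, ep]
    | succ l => simp [ee_nil_succ]
  | succ m ih =>
    cases l with
    | zero => simp [ee_zero, Lw]
    | succ l =>
      rw [List.replicate_succ, ee_cons_succ, ih, ih, mul_smul_comm, ← pow_succ', smul_smul,
        Nat.choose_succ_succ]
      rcases lt_or_ge m (l + 1) with h | h
      · rw [Nat.choose_eq_zero_of_lt h, Nat.add_sub_add_right]
        simp; ring_nf
      · rw [show m - (l + 1) + 1 = m - l by omega, Nat.add_sub_add_right, ← add_smul]
        congr 1; push_cast; ring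

lemma ee_mem (E : List ι) (k : ℕ) : ee L β E k ∈
    Submodule.span ℂ {P | ∃ J : List ι, J.length + k = E.length ∧ P = Lw L J} := by
  induction E generalizing k with
  | nil =>
    cases k with
    | zero => rw [ee_zero]; exact Submodule.subset_span ⟨[], by simp, rfl⟩
    | succ l => rw [ee_nil_succ]; exact Submodule.zero_mem _
  | cons a E ih =>
    cases k with
    | zero => rw [ee_zero]; exact Submodule.subset_span ⟨a :: E, by simp, rfl⟩
    | succ k =>
      rw [ee_cons_succ]
      refine Submodule.add_mem _ ?_ (Submodule.smul_mem _ _ ?_)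
      · have := Submodule.mem_map_of_mem (f := LinearMap.mulLeft ℂ (L a)) (ih (k + 1))
        rw [Submodule.map_span] at this
        refine Submodule.span_mono ?_ this
        rintro _ ⟨_, ⟨J, hJ, rfl⟩, rfl⟩
        exact ⟨a :: J, by simp; omega, by simp⟩
      · refine Submodule.span_mono ?_ (ih k)
        rintro _ ⟨J, hJ, rfl⟩
        exact ⟨J, by simp; omega, rfl⟩

lemma T_ee (hL : ∀ i, IsDer (L i)) (hLT : ∀ i, ∃ c : S, L i * T - T * L i = c • T)
    (E : List ι) (k : ℕ) :
    T * (ee L β E k * T ^ k) - ee L β E k * T ^ (k + 1) ∈ Gm L T E.length := by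
  have h := ee_mem (L := L) (β := β) E k
  generalize ee L β E k = e at h ⊢
  induction h using Submodule.span_induction with
  | mem x h => obtain ⟨J, hJ, rfl⟩ := h; have := T_comm hL hLT J k; rwa [hJ] at this
  | zero => simp
  | add x y _ _ hx hy =>
    have := Submodule.add_mem _ hx hy
    convert this using 1
    noncomm_ring
  | smul a x hxs hx =>
    have := Submodule.smul_of_tower_mem (Gm L T E.length) a hx
    convert this using 1
    simp only [smul_mul_assoc, mul_smul_comm, smul_sub]

end P14

end

section
namespace P14
variable {S ι : Type} [CommRing S] [Algebra ℂ S]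
variable {L : ι → Module.End ℂ S} {T : Module.End ℂ S} {I : Ideal S} {β : ι → ℂ}

lemma sub_smulE (f : S) (z : ℂ) (P : Module.End ℂ S) :
    (f - algebraMap ℂ S z) • P = f • P - z • P := by
  ext u
  simp [sub_mul, Algebra.smul_def]

lemma pow_one_zero (δ : Module.End ℂ S →ₗ[ℂ] Module.End ℂ S)
    (hδ : ∀ P Q, δ (P * Q) = P * δ Q + δ P * Q) (s : ℕ) (hs : 0 < s) : (δ ^ s) 1 = 0 := by
  obtain ⟨s, rfl⟩ : ∃ t, s = t + 1 := ⟨s - 1, by omega⟩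
  have h : δ 1 = 0 := by simpa using hδ 1 1
  rw [pow_succ, Module.End.mul_apply, h, map_zero]

/-- the standing hypotheses -/
structure Setup (L : ι → Module.End ℂ S) (T : Module.End ℂ S) (I : Ideal S) (β : ι → ℂ)
    (δ : Module.End ℂ S →ₗ[ℂ] Module.End ℂ S) (l : ℕ) : Prop where
  hL : ∀ i, IsDer (L i)
  hT : IsDer T
  hLT : ∀ i, ∃ c : S, L i * T - T * L i = c • T
  hδ : ∀ P Q, δ (P * Q) = P * δ Q + δ P * Q
  hl : 0 < l
  hI : ∀ f : S, ∃ z : ℂ, f - algebraMap ℂ S z ∈ I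
  hb : ∀ i r, 1 ≤ r → ∃ b : S, (δ ^ r) (L i) = b • T ∧ (r < l → b ∈ I) ∧
    (r = l → b - algebraMap ℂ S (β i) ∈ I)

variable {δ : Module.End ℂ S →ₗ[ℂ] Module.End ℂ S} {l : ℕ}

lemma smul_Hm (h : ∀ f : S, ∃ z : ℂ, f - algebraMap ℂ S z ∈ I) {N k : ℕ} {P} (f : S)
    (hP : P ∈ Hm L T I (N + 1) k) : f • P ∈ Hm L T I (N + 1) k := by
  obtain ⟨z, hz⟩ := h f
  have : f • P = z • P + (f - algebraMap ℂ S z) • P := by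
    rw [sub_smulE]; abel
  rw [this]
  exact Submodule.add_mem _ (Submodule.smul_mem _ _ hP)
    (IG_le_Hm (Submodule.smul_mem_smul hz (Hm_le_G hP)))

lemma claimA1 (h : Setup L T I β δ l) (E : List ι) (k s : ℕ) (hs : s < k * l) :
    (δ ^ s) (Lw L E) ∈ Hm L T I E.length k := by
  induction E generalizing k s with
  | nil =>
    rcases Nat.eq_zero_or_pos s with rfl | hs'
    · have : 0 < k := by by_contra hk; simp at hk; simp [hk] at hs
      simpa using mem_Hm (L := L) (T := T) (I := I) (N := 0) (k := k) [] 0 rfl this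
    · rw [Lw_nil, pow_one_zero δ h.hδ s hs']; exact Submodule.zero_mem _
  | cons a E ih =>
    rw [Lw_cons, leib' δ h.hδ]
    refine Submodule.sum_mem _ fun r hr => Submodule.smul_of_tower_mem _ _ ?_
    rw [Finset.mem_range] at hr
    rcases Nat.eq_zero_or_pos r with rfl | hr0
    · exact L_mul_Hm h.hL a (ih k s hs)
    · obtain ⟨b, hb, hb1, hb2⟩ := h.hb a r hr0
      rw [hb, smul_mul_assoc]
      rcases lt_or_ge r l with hrl | hrl
      · exact IG_le_Hm (Submodule.smul_mem_smul (hb1 hrl) (Hm_le_G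
          (T_mul_Hm h.hL h.hT h.hLT (ih k (s - r) (by omega)))))
      · obtain ⟨k, rfl⟩ : ∃ j, k = j + 1 := ⟨k - 1, by
          rcases k with _ | k
          · simp at hs
          · simp⟩
        rw [Nat.succ_mul] at hs
        exact smul_Hm h.hI b (T_mul_Hm h.hL h.hT h.hLT (ih k (s - r) (by omega)))

def cc (l : ℕ) : ℕ → ℕ
  | 0 => 1
  | k + 1 => ((k + 1) * l).choose l * cc l k

lemma cc_pos (l k : ℕ) : 0 < cc l k := by
  induction k with
  | zero => simp [cc]
  | succ k ih => exact Nat.mul_pos (Nat.choose_pos (by rw [Nat.succ_mul]; omega)) ih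

lemma claimA2 (h : Setup L T I β δ l) (E : List ι) (k : ℕ) :
    (δ ^ (k * l)) (Lw L E) - cc l k • (ee L β E k * T ^ k) ∈ Hm L T I E.length k := by
  induction E generalizing k with
  | nil =>
    rcases k with _ | k
    · simp [cc, ee_zero]
    · rw [Lw_nil, pow_one_zero δ h.hδ _ (by have := h.hl; positivity), ee_nil_succ]; simp
  | cons a E ih =>
    rcases k with _ | k
    · simp [cc, ee_zero]
    have hl := h.hl
    rw [Lw_cons, leib' δ h.hδ]
    have key : cc l (k + 1) • (ee L β (a :: E) (k + 1) * T ^ (k + 1)) =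
      ∑ r ∈ Finset.range ((k + 1) * l + 1), ((k + 1) * l).choose r •
        ((if r = 0 then L a * (cc l (k + 1) • (ee L β E (k + 1) * T ^ (k + 1))) else 0) +
        (if r = l then β a • (cc l k • (ee L β E k * T ^ (k + 1))) else 0)) := by
      simp only [nsmul_add, Finset.sum_add_distrib]
      rw [Finset.sum_eq_single 0, Finset.sum_eq_single l]
      · simp only [if_true, ee_cons_succ, add_mul, nsmul_add, Nat.choose_zero_right, one_smul, cc]
        congr 1
        · rw [mul_smul_comm, mul_assoc]
        · rw [mul_smul, smul_mul_assoc, smul_comm (β a)]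
      · intro r _ hr; simp [hr]
      · intro hr; exfalso; apply hr; rw [Finset.mem_range, Nat.succ_mul]; omega
      · intro r _ hr; simp [hr]
      · intro hr; simp at hr
    rw [key, ← Finset.sum_sub_distrib]
    refine Submodule.sum_mem _ fun r hr => ?_
    rw [← nsmul_sub]
    refine Submodule.smul_of_tower_mem _ _ ?_
    rw [Finset.mem_range] at hr
    rcases Nat.eq_zero_or_pos r with rfl | hr0
    · rw [if_pos rfl, if_neg (by omega), add_zero]
      simp only [pow_zero, Module.End.one_apply, Nat.sub_zero]
      rw [← mul_sub]
      exact L_mul_Hm h.hL a (ih (k + 1))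
    rw [if_neg (by omega), zero_add]
    obtain ⟨b, hb, hb1, hb2⟩ := h.hb a r hr0
    rw [hb, smul_mul_assoc]
    have hG : T * (δ ^ ((k + 1) * l - r)) (Lw L E) ∈ Gm L T (E.length + 1) :=
      Hm_le_G (T_mul_Hm h.hL h.hT h.hLT (claimA1 h E (k + 1) ((k + 1) * l - r) (by omega)))
    rcases lt_trichotomy r l with hrl | hrl | hrl
    · rw [if_neg hrl.ne, sub_zero]
      exact IG_le_Hm (Submodule.smul_mem_smul (hb1 hrl) hG)
    · rw [if_pos hrl]
      have e1 : (k + 1) * l - r = k * l := by rw [Nat.succ_mul]; omega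
      rw [e1] at hG ⊢
      have e2 : b • (T * (δ ^ (k * l)) (Lw L E)) - β a • (cc l k • (ee L β E k * T ^ (k + 1)))
        = (b - algebraMap ℂ S (β a)) • (T * (δ ^ (k * l)) (Lw L E)) +
          β a • (T * ((δ ^ (k * l)) (Lw L E) - cc l k • (ee L β E k * T ^ k)) +
          cc l k • (T * (ee L β E k * T ^ k) - ee L β E k * T ^ (k + 1))) := by
        rw [sub_smulE, mul_sub, smul_add, smul_sub, smul_sub, smul_sub,
          mul_smul_comm]
        abel
      rw [e2]
      refine Submodule.add_mem _ (IG_le_Hm (Submodule.smul_mem_smul (hb2 hrl) hG))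
        (Submodule.smul_mem _ _ (Submodule.add_mem _ (T_mul_Hm h.hL h.hT h.hLT (ih k))
          (Submodule.smul_of_tower_mem _ _ (G_le_Hm (T_ee h.hL h.hLT E k)))))
    · rw [if_neg hrl.ne', sub_zero]
      rw [Nat.succ_mul] at hr ⊢
      exact smul_Hm h.hI b (T_mul_Hm h.hL h.hT h.hLT (claimA1 h E k _ (by omega)))

lemma claimB (h : Setup L T I β δ l) (i₀ : ι) (hβ : β i₀ ≠ 0) (N : ℕ)
    (K : Submodule S (Module.End ℂ S)) (h1 : I • Gm L T N ≤ K) (h2 : Gm L T (N - 1) ≤ K)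
    (h3 : ∀ E : List ι, E.length = N → ∀ s ≤ N * l, (δ ^ s) (Lw L E) ∈ K)
    (k : ℕ) (J : List ι) (hJ : J.length + k = N) : Lw L J * T ^ k ∈ K := by
  induction k using Nat.strong_induction_on generalizing J with
  | _ k ihk =>
  have hH : Hm L T I N k ≤ K.restrictScalars ℂ :=
    Hm_le (fun J j hJ hj => ihk j hj J hJ) h1 h2
  have he : ∀ E : List ι, E.length = N → ee L β E k * T ^ k ∈ K := by
    intro E hE
    have ha := claimA2 h E k
    rw [hE] at ha
    have hb := Submodule.sub_mem _ (h3 E hE (k * l) (Nat.mul_le_mul_right _ (by omega))) (hH ha)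
    rw [sub_sub_cancel] at hb
    have hc := Submodule.smul_of_tower_mem K ((cc l k : ℂ)⁻¹) hb
    rwa [← Nat.cast_smul_eq_nsmul ℂ, smul_smul, inv_mul_cancel₀, one_smul] at hc
    exact_mod_cast (cc_pos l k).ne'
  have main : ∀ m, ∀ J : List ι, J.length = m → ∀ j, m + j + k = N →
      Lw L J * L i₀ ^ j * T ^ k ∈ K := by
    intro m
    induction m using Nat.strong_induction_on with
    | _ m ihm =>
    intro J hJ j hj
    have ha := he (J ++ List.replicate (j + k) i₀) (by simp; omega)
    rw [ee_append, Finset.sum_mul] at ha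
    have hmem : ((0, k) : ℕ × ℕ) ∈ Finset.HasAntidiagonal.antidiagonal k := by simp
    rw [← Finset.add_sum_erase _ _ hmem] at ha
    have hb : ∑ x ∈ (Finset.HasAntidiagonal.antidiagonal k).erase (0, k),
        ee L β J x.1 * ee L β (List.replicate (j + k) i₀) x.2 * T ^ k ∈ K := by
      refine Submodule.sum_mem _ ?_
      rintro ⟨i, r⟩ hir
      rw [Finset.mem_erase, Finset.HasAntidiagonal.mem_antidiagonal] at hir
      obtain ⟨hne, hir⟩ := hir
      simp only at hir ⊢
      have hi : 0 < i := by
        rcases Nat.eq_zero_or_pos i with rfl | hi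
        · simp at hir; simp [hir] at hne
        · exact hi
      rw [ee_replicate, mul_smul_comm, smul_mul_assoc]
      refine Submodule.smul_of_tower_mem K _ ?_
      have hm := ee_mem (L := L) (β := β) J i
      generalize ee L β J i = e at hm ⊢
      induction hm using Submodule.span_induction with
      | mem x hx =>
        obtain ⟨J', hJ', rfl⟩ := hx
        exact ihm J'.length (by omega) J' rfl (j + k - r) (by omega)
      | zero => simp
      | add x y _ _ hx hy => rw [add_mul, add_mul]; exact Submodule.add_mem _ hx hy
      | smul a x _ hx =>
        rw [smul_mul_assoc, smul_mul_assoc]; exact Submodule.smul_of_tower_mem K _ hx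
    have hc := Submodule.sub_mem _ ha hb
    rw [add_sub_cancel_right] at hc
    simp only [ee_zero, ee_replicate, mul_smul_comm, smul_mul_assoc, Nat.add_sub_cancel] at hc
    have hd := Submodule.smul_of_tower_mem K ((((j + k).choose k : ℂ) * β i₀ ^ k)⁻¹) hc
    rwa [smul_smul, inv_mul_cancel₀, one_smul] at hd
    refine mul_ne_zero ?_ (pow_ne_zero _ hβ)
    exact_mod_cast (Nat.choose_pos (by omega)).ne'
  simpa using main J.length J rfl 0 (by omega)

lemma mainle (h : Setup L T I β δ l) (i₀ : ι) (hβ : β i₀ ≠ 0)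
    (K : ℕ → Submodule S (Module.End ℂ S)) (hK : Monotone K)
    (h3 : ∀ N, 1 ≤ N → ∀ E : List ι, E.length = N → ∀ s ≤ N * l, (δ ^ s) (Lw L E) ∈ K N) (N : ℕ) :
    Gm L T N ≤ K N ⊔ I • Gm L T N := by
  induction N with
  | zero => rw [Gm_zero]; exact bot_le
  | succ N ih =>
    have hle : Gm L T N ≤ K (N + 1) ⊔ I • Gm L T (N + 1) :=
      ih.trans (sup_le_sup (hK (by omega)) (Submodule.smul_mono le_rfl (Gm_mono L T (by omega))))
    refine Submodule.span_le.2 ?_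
    rintro P ⟨J, j, hj1, hj2, rfl⟩
    rcases Nat.lt_or_ge (J.length + j) (N + 1) with hlt | hge
    · exact hle (mem_Gm L T J j hj1 (by omega))
    · exact claimB h i₀ hβ (N + 1) _ le_sup_right hle
        (fun E hE s hs => Submodule.mem_sup_left (h3 (N + 1) (by omega) E hE s hs)) j J (by omega)

lemma final [Finite ι] (h : Setup L T I β δ l) (i₀ : ι) (hβ : β i₀ ≠ 0)
    (K : ℕ → Submodule S (Module.End ℂ S)) (hK : Monotone K)
    (h3 : ∀ N, 1 ≤ N → ∀ E : List ι, E.length = N → ∀ s ≤ N * l, (δ ^ s) (Lw L E) ∈ K N)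
    (J : List ι) (k : ℕ) (hk : 1 ≤ k) :
    ∃ g : S, g - 1 ∈ I ∧ g • (Lw L J * T ^ k) ∈ K (J.length + k) := by
  obtain ⟨r, hr, hr'⟩ := Submodule.exists_sub_one_mem_and_smul_le_of_fg_of_le_sup
    (Gm_fg L T (J.length + k)) le_rfl (mainle h i₀ hβ K hK h3 (J.length + k))
  refine ⟨r, hr, hr' ?_⟩
  exact Submodule.smul_mem_pointwise_smul _ _ _ (mem_Gm L T _ _ (by omega) le_rfl)

end P14

end

section
namespace P14
variable {m : ℕ}

lemma vapp_congr {X : VF m} {u w : (Fin m → ℝ) → ℂ} {x} (h : u =ᶠ[𝓝 x] w) :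
    vapp X u x = vapp X w x := by
  simp only [vapp, h.fderiv_eq]

lemma vapp_add {X : VF m} {u w : (Fin m → ℝ) → ℂ} {x} (hu : DifferentiableAt ℝ u x)
    (hw : DifferentiableAt ℝ w x) : vapp X (u + w) x = vapp X u x + vapp X w x := by
  simp only [vapp, fderiv_add hu hw, ← Finset.sum_add_distrib]
  exact Finset.sum_congr rfl fun i _ => by simp; ring

lemma vapp_smul {X : VF m} {u : (Fin m → ℝ) → ℂ} {x} (hu : DifferentiableAt ℝ u x) (c : ℂ) :
    vapp X (c • u) x = c * vapp X u x := by
  simp only [vapp, fderiv_const_smul hu, Finset.mul_sum]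
  exact Finset.sum_congr rfl fun i _ => by simp; ring

lemma vapp_mul {X : VF m} {u w : (Fin m → ℝ) → ℂ} {x} (hu : DifferentiableAt ℝ u x)
    (hw : DifferentiableAt ℝ w x) : vapp X (u * w) x = u x * vapp X w x + vapp X u x * w x := by
  simp only [vapp, fderiv_mul hu hw, Finset.mul_sum, Finset.sum_mul, ← Finset.sum_add_distrib]
  exact Finset.sum_congr rfl fun i _ => by simp; ring

lemma comp_smooth {Ω : Set (Fin m → ℝ)} {X : VF m} (hX : ContDiffOn ℝ (⊤ : ℕ∞) X Ω) (i : Fin m) :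
    ContDiffOn ℝ (⊤ : ℕ∞) (fun y => X y i) Ω := (contDiffOn_pi.1 hX) i

lemma fderiv_smooth {Ω : Set (Fin m → ℝ)} (hΩ : IsOpen Ω) {u : (Fin m → ℝ) → ℂ}
    (hu : ContDiffOn ℝ (⊤ : ℕ∞) u Ω) : ContDiffOn ℝ (⊤ : ℕ∞) (fderiv ℝ u) Ω :=
  hu.fderiv_of_isOpen hΩ (by simp)

lemma vapp_smooth {Ω : Set (Fin m → ℝ)} (hΩ : IsOpen Ω) {X : VF m} {u : (Fin m → ℝ) → ℂ}
    (hX : ContDiffOn ℝ (⊤ : ℕ∞) X Ω) (hu : ContDiffOn ℝ (⊤ : ℕ∞) u Ω) :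
    ContDiffOn ℝ (⊤ : ℕ∞) (vapp X u) Ω := by
  unfold vapp
  refine ContDiffOn.sum fun i _ => (comp_smooth hX i).mul ?_
  exact (fderiv_smooth hΩ hu).clm_apply contDiffOn_const

lemma vbrk_smooth {Ω : Set (Fin m → ℝ)} (hΩ : IsOpen Ω) {X Y : VF m}
    (hX : ContDiffOn ℝ (⊤ : ℕ∞) X Ω) (hY : ContDiffOn ℝ (⊤ : ℕ∞) Y Ω) :
    ContDiffOn ℝ (⊤ : ℕ∞) (vbrk X Y) Ω := by
  refine contDiffOn_pi.2 fun j => ?_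
  exact (vapp_smooth hΩ hX (comp_smooth hY j)).sub (vapp_smooth hΩ hY (comp_smooth hX j))

lemma vconj_smooth {Ω : Set (Fin m → ℝ)} {X : VF m}
    (hX : ContDiffOn ℝ (⊤ : ℕ∞) X Ω) : ContDiffOn ℝ (⊤ : ℕ∞) (vconj X) Ω := by
  refine contDiffOn_pi.2 fun j => ?_
  exact Complex.conjCLE.contDiff.comp_contDiffOn (comp_smooth hX j)

lemma sm_diffAt {Ω : Set (Fin m → ℝ)} (hΩ : IsOpen Ω) {F : Type} [NormedAddCommGroup F]
    [NormedSpace ℝ F] {u : (Fin m → ℝ) → F}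
    (hu : ContDiffOn ℝ (⊤ : ℕ∞) u Ω) {x} (hx : x ∈ Ω) : DifferentiableAt ℝ u x :=
  (hu.contDiffAt (hΩ.mem_nhds hx)).differentiableAt (by simp)

lemma fderiv_vapp {Ω : Set (Fin m → ℝ)} (hΩ : IsOpen Ω) {Y : VF m} {u : (Fin m → ℝ) → ℂ}
    (hY : ContDiffOn ℝ (⊤ : ℕ∞) Y Ω) (hu : ContDiffOn ℝ (⊤ : ℕ∞) u Ω) {x} (hx : x ∈ Ω)
    (v : Fin m → ℝ) : fderiv ℝ (vapp Y u) x v =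
      ∑ i, (fderiv ℝ (fun y => Y y i) x v * fderiv ℝ u x (Pi.single i 1) +
        Y x i * fderiv ℝ (fderiv ℝ u) x v (Pi.single i 1)) := by
  have h : HasFDerivAt (vapp Y u) (∑ i, (Y x i • ((fderiv ℝ (fderiv ℝ u) x).flip (Pi.single i 1)) +
      (fderiv ℝ u x (Pi.single i 1)) • fderiv ℝ (fun y => Y y i) x)) x := by
    unfold vapp
    refine HasFDerivAt.fun_sum fun i _ => ?_
    have h1 : HasFDerivAt (fun y => fderiv ℝ u y (Pi.single i 1))
        ((fderiv ℝ (fderiv ℝ u) x).flip (Pi.single i 1)) x := by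
      have := (sm_diffAt hΩ (fderiv_smooth hΩ hu) hx).hasFDerivAt
      have h2 := this.clm_apply (hasFDerivAt_const (Pi.single i (1 : ℝ)) x)
      rw [ContinuousLinearMap.comp_zero, zero_add] at h2
      exact h2
    exact (sm_diffAt hΩ (comp_smooth hY i) hx).hasFDerivAt.mul h1
  rw [h.fderiv, sum_apply]
  refine Finset.sum_congr rfl fun i _ => ?_
  simp
  ring

lemma vapp_brk {Ω : Set (Fin m → ℝ)} (hΩ : IsOpen Ω) {X Y : VF m} {u : (Fin m → ℝ) → ℂ}
    (hX : ContDiffOn ℝ (⊤ : ℕ∞) X Ω)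
    (hY : ContDiffOn ℝ (⊤ : ℕ∞) Y Ω) (hu : ContDiffOn ℝ (⊤ : ℕ∞) u Ω) {x} (hx : x ∈ Ω) :
    vapp (vbrk X Y) u x = vapp X (vapp Y u) x - vapp Y (vapp X u) x := by
  have hs : ∀ v w, fderiv ℝ (fderiv ℝ u) x v w = fderiv ℝ (fderiv ℝ u) x w v := by
    have : IsSymmSndFDerivAt ℝ u x :=
      (hu.contDiffAt (hΩ.mem_nhds hx)).isSymmSndFDerivAt
        (by simp only [minSmoothness_of_isRCLikeNormedField]; exact WithTop.coe_le_coe.2 (le_top : (2 : ℕ∞) ≤ ⊤))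
    exact fun v w => this v w
  have e : ∀ A B : VF m, ContDiffOn ℝ (⊤ : ℕ∞) A Ω → ContDiffOn ℝ (⊤ : ℕ∞) B Ω →
    vapp A (vapp B u) x = (∑ i, vapp A (fun y => B y i) x * fderiv ℝ u x (Pi.single i 1)) +
      ∑ j, ∑ i, A x j * B x i * fderiv ℝ (fderiv ℝ u) x (Pi.single j 1) (Pi.single i 1) := by
    intro A B hA hB
    conv_lhs => rw [vapp]
    simp only [fderiv_vapp hΩ hB hu hx, Finset.sum_add_distrib, mul_add]
    congr 1
    · simp only [vapp, Finset.sum_mul, Finset.mul_sum]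
      rw [Finset.sum_comm]
      exact Finset.sum_congr rfl fun i _ => Finset.sum_congr rfl fun j _ => by ring
    · simp only [Finset.mul_sum]
      exact Finset.sum_congr rfl fun i _ => Finset.sum_congr rfl fun j _ => by ring
  rw [e X Y hX hY, e Y X hY hX]
  have e2 : ∑ j, ∑ i, X x j * Y x i * fderiv ℝ (fderiv ℝ u) x (Pi.single j 1) (Pi.single i 1)
     = ∑ j, ∑ i, Y x j * X x i * fderiv ℝ (fderiv ℝ u) x (Pi.single j 1) (Pi.single i 1) := by
    rw [Finset.sum_comm]
    refine Finset.sum_congr rfl fun i _ => Finset.sum_congr rfl fun j _ => ?_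
    rw [hs]; ring
  rw [e2, add_sub_add_right_eq_sub, ← Finset.sum_sub_distrib]
  conv_lhs => rw [vapp]
  refine Finset.sum_congr rfl fun i _ => ?_
  simp only [vbrk]
  ring

lemma vapp_conj {X : VF m} {u : (Fin m → ℝ) → ℂ} {x} (hu : DifferentiableAt ℝ u x) :
    vapp (vconj X) (fun y => (starRingEnd ℂ) (u y)) x = (starRingEnd ℂ) (vapp X u x) := by
  have : HasFDerivAt (fun y => (starRingEnd ℂ) (u y))
      ((Complex.conjCLE : ℂ →L[ℝ] ℂ).comp (fderiv ℝ u x)) x :=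
    (Complex.conjCLE : ℂ →L[ℝ] ℂ).hasFDerivAt.comp x hu.hasFDerivAt
  simp only [vapp, this.fderiv, map_sum, map_mul, vconj]
  simp

lemma vbrk_conj {Ω : Set (Fin m → ℝ)} (hΩ : IsOpen Ω) {X Y : VF m}
    (hX : ContDiffOn ℝ (⊤ : ℕ∞) X Ω) (hY : ContDiffOn ℝ (⊤ : ℕ∞) Y Ω) {x} (hx : x ∈ Ω) :
    vbrk (vconj X) (vconj Y) x = vconj (vbrk X Y) x := by
  funext j
  simp only [vbrk, vconj, map_sub]
  rw [← vapp_conj (sm_diffAt hΩ (comp_smooth hY j) hx),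
    ← vapp_conj (sm_diffAt hΩ (comp_smooth hX j) hx)]

/-- smooth functions on Ω -/
def SS (Ω : Set (Fin m → ℝ)) : Subalgebra ℂ ((Fin m → ℝ) → ℂ) where
  carrier := {f | ContDiffOn ℝ (⊤ : ℕ∞) f Ω}
  mul_mem' := fun ha hb => ContDiffOn.mul ha hb
  add_mem' := fun ha hb => ContDiffOn.add ha hb
  algebraMap_mem' := fun _ => contDiffOn_const

lemma SS_sm {Ω : Set (Fin m → ℝ)} (u : SS Ω) : ContDiffOn ℝ (⊤ : ℕ∞) u.1 Ω := u.2

open Classical in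
/-- the operator on smooth functions attached to a vector field -/
def vop {Ω : Set (Fin m → ℝ)} (hΩ : IsOpen Ω) (X : VF m) (hX : ContDiffOn ℝ (⊤ : ℕ∞) X Ω) :
    Module.End ℂ (SS Ω) where
  toFun u := ⟨fun x => if x ∈ Ω then vapp X u.1 x else 0,
    (vapp_smooth hΩ hX u.2).congr fun x hx => by simp [hx]⟩
  map_add' u w := by
    apply Subtype.ext; funext x
    by_cases hx : x ∈ Ω
    · have := vapp_add (X := X) (sm_diffAt hΩ u.2 hx) (sm_diffAt hΩ w.2 hx)
      simpa [hx] using this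
    · simp [hx]
  map_smul' c u := by
    apply Subtype.ext; funext x
    by_cases hx : x ∈ Ω
    · have := vapp_smul (X := X) (sm_diffAt hΩ u.2 hx) c
      simpa [hx] using this
    · simp [hx]

lemma vop_in {Ω : Set (Fin m → ℝ)} (hΩ : IsOpen Ω) {X : VF m} (hX : ContDiffOn ℝ (⊤ : ℕ∞) X Ω)
    (u : SS Ω) {x} (hx : x ∈ Ω) : (vop hΩ X hX u).1 x = vapp X u.1 x := by simp [vop, hx]

lemma vop_out {Ω : Set (Fin m → ℝ)} (hΩ : IsOpen Ω) {X : VF m} (hX : ContDiffOn ℝ (⊤ : ℕ∞) X Ω)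
    (u : SS Ω) {x} (hx : x ∉ Ω) : (vop hΩ X hX u).1 x = 0 := by simp [vop, hx]

lemma vop_der {Ω : Set (Fin m → ℝ)} (hΩ : IsOpen Ω) {X : VF m} (hX : ContDiffOn ℝ (⊤ : ℕ∞) X Ω) :
    IsDer (vop hΩ X hX) := by
  intro u w
  apply Subtype.ext; funext x
  show (vop hΩ X hX (u * w)).1 x = u.1 x * (vop hΩ X hX w).1 x + (vop hΩ X hX u).1 x * w.1 x
  by_cases hx : x ∈ Ω
  · rw [vop_in _ _ _ hx, vop_in _ _ _ hx, vop_in _ _ _ hx]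
    exact vapp_mul (sm_diffAt hΩ u.2 hx) (sm_diffAt hΩ w.2 hx)
  · rw [vop_out _ _ _ hx, vop_out _ _ _ hx, vop_out _ _ _ hx]; simp

lemma vop_congr {Ω : Set (Fin m → ℝ)} (hΩ : IsOpen Ω) {X Y : VF m}
    (hX : ContDiffOn ℝ (⊤ : ℕ∞) X Ω) (hY : ContDiffOn ℝ (⊤ : ℕ∞) Y Ω) (f : SS Ω)
    (h : ∀ x ∈ Ω, X x = fun i => f.1 x * Y x i) : vop hΩ X hX = f • vop hΩ Y hY := by
  ext u x
  show (vop hΩ X hX u).1 x = f.1 x * (vop hΩ Y hY u).1 x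
  by_cases hx : x ∈ Ω
  · rw [vop_in _ _ _ hx, vop_in _ _ _ hx, vapp, vapp, h x hx, Finset.mul_sum]
    exact Finset.sum_congr rfl fun i _ => by ring
  · rw [vop_out _ _ _ hx, vop_out _ _ _ hx]; simp

lemma vop_brk {Ω : Set (Fin m → ℝ)} (hΩ : IsOpen Ω) {X Y : VF m}
    (hX : ContDiffOn ℝ (⊤ : ℕ∞) X Ω) (hY : ContDiffOn ℝ (⊤ : ℕ∞) Y Ω) :
    vop hΩ (vbrk X Y) (vbrk_smooth hΩ hX hY) =
      vop hΩ X hX * vop hΩ Y hY - vop hΩ Y hY * vop hΩ X hX := by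
  ext u x
  show (vop hΩ _ _ u).1 x = (vop hΩ X hX (vop hΩ Y hY u)).1 x - (vop hΩ Y hY (vop hΩ X hX u)).1 x
  by_cases hx : x ∈ Ω
  · rw [vop_in _ _ _ hx, vop_in _ _ _ hx, vop_in _ _ _ hx, vapp_brk hΩ hX hY u.2 hx]
    congr 1
    · refine vapp_congr ?_
      filter_upwards [hΩ.mem_nhds hx] with y hy
      rw [vop_in _ _ _ hy]
    · refine vapp_congr ?_
      filter_upwards [hΩ.mem_nhds hx] with y hy
      rw [vop_in _ _ _ hy]
  · rw [vop_out _ _ _ hx, vop_out _ _ _ hx, vop_out _ _ _ hx]; simp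

/-- compatibility of raw operators with endomorphisms -/
structure Rel {Ω : Set (Fin m → ℝ)} (P : Op m) (Q : Module.End ℂ (SS Ω)) : Prop where
  eq : ∀ (u : SS Ω), ∀ x ∈ Ω, P u.1 x = (Q u).1 x
  loc : ∀ (u w : (Fin m → ℝ) → ℂ) x, u =ᶠ[𝓝 x] w → P u x = P w x

lemma Rel.vop {Ω : Set (Fin m → ℝ)} (hΩ : IsOpen Ω) {X : VF m} (hX : ContDiffOn ℝ (⊤ : ℕ∞) X Ω) :
    Rel (opOf X) (vop hΩ X hX) :=
  ⟨fun u x hx => (vop_in hΩ hX u hx).symm, fun _ _ _ h => vapp_congr h⟩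

lemma Rel.comp {Ω : Set (Fin m → ℝ)} (hΩ : IsOpen Ω) {P P' : Op m} {Q Q' : Module.End ℂ (SS Ω)}
    (h : Rel P Q) (h' : Rel P' Q') : Rel (fun u => P (P' u)) (Q * Q') := by
  constructor
  · intro u x hx
    show P (P' u.1) x = (Q (Q' u)).1 x
    rw [← h.eq _ x hx]
    refine h.loc _ _ _ ?_
    filter_upwards [hΩ.mem_nhds hx] with y hy
    exact h'.eq u y hy
  · intro u w x huw
    refine h.loc _ _ _ ?_
    filter_upwards [huw.eventuallyEq_nhds] with y hy
    exact h'.loc _ _ _ hy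

lemma Rel.ocomm {Ω : Set (Fin m → ℝ)} (hΩ : IsOpen Ω) {P P' : Op m} {Q Q' : Module.End ℂ (SS Ω)}
    (h : Rel P Q) (h' : Rel P' Q') : Rel (ocomm P P') (Q * Q' - Q' * Q) := by
  constructor
  · intro u x hx
    have h1 := (h.comp hΩ h').eq u x hx
    have h2 := (h'.comp hΩ h).eq u x hx
    show P (P' u.1) x - P' (P u.1) x = ((Q * Q') u).1 x - ((Q' * Q) u).1 x
    rw [h1, h2]
  · intro u w x huw
    have h1 := (h.comp hΩ h').loc u w x huw
    have h2 := (h'.comp hΩ h).loc u w x huw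
    show P (P' u) x - P' (P u) x = P (P' w) x - P' (P w) x
    rw [h1, h2]

lemma Rel.one {Ω : Set (Fin m → ℝ)} : Rel (fun u => u) (1 : Module.End ℂ (SS Ω)) :=
  ⟨fun _ _ _ => rfl, fun _ _ _ h => h.self_of_nhds⟩

lemma Rel.pow {Ω : Set (Fin m → ℝ)} (hΩ : IsOpen Ω) {P : Op m} {Q : Module.End ℂ (SS Ω)}
    (h : Rel P Q) (k : ℕ) : Rel (fun u => P^[k] u) (Q ^ k) := by
  induction k with
  | zero => simpa using Rel.one
  | succ k ih =>
    have := h.comp hΩ ih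
    simpa only [Function.iterate_succ_apply', pow_succ'] using this

/-- iterated commutators of endomorphisms -/
def itc {ι S : Type} [CommRing S] [Algebra ℂ S] (B : ι → Module.End ℂ S) (P : Module.End ℂ S)
    (Fs : List ι) : Module.End ℂ S := Fs.foldl (fun Q F => Q * B F - B F * Q) P

lemma Rel.itc {n : ℕ} {Ω : Set (Fin (2 * n + 1) → ℝ)} (hΩ : IsOpen Ω)
    {L : Fin n → VF (2 * n + 1)} {B : Fin n → Module.End ℂ (SS Ω)}
    (hB : ∀ F, Rel (opOf (vconj (L F))) (B F)) (Fs : List (Fin n))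
    {P : Op (2 * n + 1)} {Q : Module.End ℂ (SS Ω)} (h : Rel P Q) :
    Rel (opItcBar L P Fs) (itc B Q Fs) := by
  induction Fs generalizing P Q with
  | nil => exact h
  | cons F Fs ih => exact ih (h.ocomm hΩ (hB F))

lemma Rel.appOp {n : ℕ} {Ω : Set (Fin (2 * n + 1) → ℝ)} (hΩ : IsOpen Ω)
    {L : Fin n → VF (2 * n + 1)} {Lo : Fin n → Module.End ℂ (SS Ω)}
    (hB : ∀ F, Rel (opOf (L F)) (Lo F)) (J : List (Fin n)) :
    Rel (appOp L J) (Lw Lo J) := by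
  induction J with
  | nil => rw [Lw_nil]; exact Rel.one
  | cons F Fs ih => rw [Lw_cons]; exact (hB F).comp hΩ ih

lemma vItc_op {n : ℕ} {Ω : Set (Fin (2 * n + 1) → ℝ)} (hΩ : IsOpen Ω)
    {L : Fin n → VF (2 * n + 1)} (hL : ∀ F, ContDiffOn ℝ (⊤ : ℕ∞) (L F) Ω) (Fs : List (Fin n))
    (X : VF (2 * n + 1)) (hX : ContDiffOn ℝ (⊤ : ℕ∞) X Ω) :
    ∃ h : ContDiffOn ℝ (⊤ : ℕ∞) (vItcBar L X Fs) Ω, P14.vop hΩ (vItcBar L X Fs) h =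
      P14.itc (fun F => P14.vop hΩ (vconj (L F)) (vconj_smooth (hL F))) (P14.vop hΩ X hX) Fs := by
  induction Fs generalizing X with
  | nil => exact ⟨hX, rfl⟩
  | cons F Fs ih =>
    obtain ⟨h, h'⟩ := ih _ (vbrk_smooth hΩ hX (vconj_smooth (hL F)))
    refine ⟨h, ?_⟩
    rw [vop_brk] at h'
    exact h'

lemma itc_perm {ι S : Type} [CommRing S] [Algebra ℂ S] (B : ι → Module.End ℂ S)
    (hB : ∀ i j, B i * B j = B j * B i) (P : Module.End ℂ S) {l l' : List ι} (h : l.Perm l') :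
    itc B P l = itc B P l' := by
  have : RightCommutative (fun (Q : Module.End ℂ S) F => Q * B F - B F * Q) := ⟨by
    intro Q F G
    have := hB F G
    simp only [sub_mul, mul_sub, mul_assoc]
    rw [this, ← mul_assoc (B F) (B G), this, mul_assoc]
    abel⟩
  exact h.foldl_eq P

/-- the combined commutator -/
def dl {n : ℕ} {S : Type} [CommRing S] [Algebra ℂ S] (B : Fin n → Module.End ℂ S) (v : Fin n → ℂ) :
    Module.End ℂ S →ₗ[ℂ] Module.End ℂ S :=
  ∑ F, v F • (LinearMap.mulRight ℂ (B F) - LinearMap.mulLeft ℂ (B F))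

lemma dl_apply {n : ℕ} {S : Type} [CommRing S] [Algebra ℂ S] (B : Fin n → Module.End ℂ S)
    (v : Fin n → ℂ) (P) : dl B v P = ∑ F, v F • (P * B F - B F * P) := by
  simp [dl]

lemma dl_der {n : ℕ} {S : Type} [CommRing S] [Algebra ℂ S] (B : Fin n → Module.End ℂ S)
    (v : Fin n → ℂ) (P Q) : dl B v (P * Q) = P * dl B v Q + dl B v P * Q := by
  simp only [dl_apply, Finset.mul_sum, Finset.sum_mul, ← Finset.sum_add_distrib, mul_smul_comm,
    smul_mul_assoc, ← smul_add]
  refine Finset.sum_congr rfl fun F _ => ?_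
  congr 1
  rw [mul_sub, sub_mul]
  simp only [mul_assoc]
  abel

lemma dl_pow {n : ℕ} {S : Type} [CommRing S] [Algebra ℂ S] (B : Fin n → Module.End ℂ S)
    (v : Fin n → ℂ) (r : ℕ) (P) : (dl B v ^ r) P =
      ∑ F : Fin r → Fin n, ((List.ofFn F).map v).prod • itc B P (List.ofFn F) := by
  induction r generalizing P with
  | zero => simp [itc]
  | succ r ih =>
    rw [pow_succ, Module.End.mul_apply, dl_apply, map_sum,
      ← (Fin.consEquiv (fun _ => Fin n)).sum_comp, Fintype.sum_prod_type]
    refine Finset.sum_congr rfl fun F _ => ?_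
    rw [map_smul, ih, Finset.smul_sum]
    refine Finset.sum_congr rfl fun G _ => ?_
    simp [Fin.consEquiv, List.ofFn_succ, mul_smul, itc]

lemma polar {n l : ℕ} (a : List (Fin n) → ℂ) (ha : ∀ F F', F.length = l → F.Perm F' → a F = a F')
    (F0 : List (Fin n)) (hF0 : F0.length = l) (h0 : a F0 ≠ 0) :
    ∃ v : Fin n → ℂ, ∑ F : Fin l → Fin n, ((List.ofFn F).map v).prod * a (List.ofFn F) ≠ 0 := by
  classical
  by_contra! hcon
  let mm : List (Fin n) → (Fin n →₀ ℕ) := fun F => Multiset.toFinsupp (F : Multiset (Fin n))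
  have hmm : ∀ F : List (Fin n), (F.map (MvPolynomial.X (R := ℂ))).prod
      = MvPolynomial.monomial (mm F) 1 := by
    intro F
    induction F with
    | nil => simp [mm]
    | cons b F ih =>
      rw [List.map_cons, List.prod_cons, ih, MvPolynomial.X, MvPolynomial.monomial_mul, one_mul]
      congr 1
      simp only [mm, ← Multiset.cons_coe, ← Multiset.singleton_add, map_add,
        Multiset.toFinsupp_singleton]
  let p : MvPolynomial (Fin n) ℂ := ∑ F : Fin l → Fin n,
    MvPolynomial.C (a (List.ofFn F)) * ((List.ofFn F).map MvPolynomial.X).prod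
  have hp : p = 0 := by
    refine MvPolynomial.funext fun v => ?_
    rw [map_zero, ← hcon v]
    simp only [p, map_sum, map_mul, MvPolynomial.eval_C, map_list_prod, List.map_map]
    refine Finset.sum_congr rfl fun F _ => ?_
    rw [mul_comm]
    congr 3
    funext i; simp
  have hc : p.coeff (mm F0) = ∑ F : Fin l → Fin n, if mm (List.ofFn F) = mm F0 then a F0 else 0 := by
    simp only [p, MvPolynomial.coeff_sum, MvPolynomial.coeff_C_mul, hmm, MvPolynomial.coeff_monomial]
    refine Finset.sum_congr rfl fun F _ => ?_
    split_ifs with h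
    · rw [mul_one]
      refine ha _ _ (by simp) ?_
      have := Multiset.toFinsupp.injective h
      exact Multiset.coe_eq_coe.1 this
    · simp
  rw [hp, ← Finset.sum_filter, Finset.sum_const] at hc
  simp only [MvPolynomial.coeff_zero] at hc
  have hc' := hc.symm
  rw [smul_eq_zero] at hc'
  rcases hc' with hc' | hc'
  · rw [Finset.card_eq_zero, Finset.filter_eq_empty_iff] at hc'
    subst hF0
    exact hc' (x := F0.get) (Finset.mem_univ _) (by rw [List.ofFn_get])
  · exact h0 hc'

end P14

end

section
namespace P14

lemma sum_rep {n l N : ℕ} {S M : Type} [CommRing S] [AddCommGroup M] [Module S M]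
    (G : List (Fin n) → List (Fin n) → M) {Q : M}
    (hQ : Q ∈ Submodule.span S {P | ∃ Es Fs, 1 ≤ Es.length ∧ Es.length ≤ N ∧
      Fs.length ≤ Es.length * l ∧ P = G Es Fs}) :
    ∃ c : List (Fin n) → List (Fin n) → S, Q = ∑ m' ∈ Finset.Icc 1 N,
      ∑ s ∈ Finset.range (m' * l + 1), ∑ Es : Fin m' → Fin n, ∑ Fs : Fin s → Fin n,
        c (List.ofFn Es) (List.ofFn Fs) • G (List.ofFn Es) (List.ofFn Fs) := by
  classical
  induction hQ using Submodule.span_induction with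
  | mem P h =>
    obtain ⟨Es, Fs, h1, h2, h3, rfl⟩ := h
    refine ⟨fun A B => if A = Es ∧ B = Fs then 1 else 0, ?_⟩
    rw [Finset.sum_eq_single Es.length]
    · rw [Finset.sum_eq_single Fs.length]
      · rw [Finset.sum_eq_single Es.get]
        · rw [Finset.sum_eq_single Fs.get]
          · simp only [List.ofFn_get, and_self, if_true, one_smul]
          · intro b _ hb
            dsimp only
            rw [if_neg, zero_smul]
            rintro ⟨-, hc⟩
            apply hb
            apply List.ofFn_injective
            rw [hc, List.ofFn_get]
          · simp
        · intro b _ hb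
          refine Finset.sum_eq_zero fun c _ => ?_
          dsimp only
          rw [if_neg, zero_smul]
          rintro ⟨hc, -⟩
          apply hb
          apply List.ofFn_injective
          rw [hc, List.ofFn_get]
        · simp
      · intro b _ hb
        refine Finset.sum_eq_zero fun A _ => Finset.sum_eq_zero fun B _ => ?_
        dsimp only
        rw [if_neg, zero_smul]
        rintro ⟨-, hc⟩
        apply hb
        rw [← hc, List.length_ofFn]
      · intro h
        exact absurd (Finset.mem_range.2 (by omega)) h
    · intro b _ hb
      refine Finset.sum_eq_zero fun s _ =>
        Finset.sum_eq_zero fun A _ => Finset.sum_eq_zero fun B _ => ?_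
      dsimp only
      rw [if_neg, zero_smul]
      rintro ⟨hc, -⟩
      apply hb
      rw [← hc, List.length_ofFn]
    · intro h
      exact absurd (Finset.mem_Icc.2 ⟨h1, h2⟩) h
  | zero => exact ⟨fun _ _ => 0, by simp⟩
  | add x y _ _ hx hy =>
    obtain ⟨c, rfl⟩ := hx
    obtain ⟨d, rfl⟩ := hy
    refine ⟨fun A B => c A B + d A B, ?_⟩
    simp only [add_smul, Finset.sum_add_distrib]
  | smul a x _ hx =>
    obtain ⟨c, rfl⟩ := hx
    refine ⟨fun A B => a * c A B, ?_⟩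
    simp only [mul_smul, Finset.smul_sum]

lemma final2 {n ℓ₀ : ℕ} {S : Type} [CommRing S] [Algebra ℂ S]
    {Lo Lb : Fin n → Module.End ℂ S} {To : Module.End ℂ S} {I : Ideal S} {β : Fin n → ℂ}
    {v : Fin n → ℂ} (hset : Setup Lo To I β (dl Lb v) ℓ₀) (i₀ : Fin n) (hβ : β i₀ ≠ 0)
    (J : List (Fin n)) (k : ℕ) (hk : 1 ≤ k) :
    ∃ g : S, g - 1 ∈ I ∧ ∃ c : List (Fin n) → List (Fin n) → S,
      ∀ w : S, g * (Lw Lo J * To ^ k) w = ∑ m' ∈ Finset.Icc 1 (J.length + k),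
      ∑ s ∈ Finset.range (m' * ℓ₀ + 1), ∑ Es : Fin m' → Fin n, ∑ Fs : Fin s → Fin n,
        c (List.ofFn Es) (List.ofFn Fs) * itc Lb (Lw Lo (List.ofFn Es)) (List.ofFn Fs) w := by
  obtain ⟨K, hKd⟩ : ∃ K : ℕ → Submodule S (Module.End ℂ S), ∀ N, K N =
    Submodule.span S {P | ∃ Es Fs, 1 ≤ Es.length ∧ Es.length ≤ N ∧
      Fs.length ≤ Es.length * ℓ₀ ∧ P = itc Lb (Lw Lo Es) Fs} := ⟨_, fun _ => rfl⟩
  have hK : Monotone K := by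
    intro a b hab
    rw [hKd, hKd]
    refine Submodule.span_mono ?_
    rintro P ⟨Es, Fs, h1, h2, h3⟩
    exact ⟨Es, Fs, h1, h2.trans hab, h3⟩
  obtain ⟨g, hg, hg'⟩ := final hset i₀ hβ K hK (by
    intro N hN E hE s hs
    rw [dl_pow, hKd]
    refine Submodule.sum_mem _ fun F _ => ?_
    refine Submodule.smul_of_tower_mem _ _ (Submodule.subset_span ?_)
    exact ⟨E, List.ofFn F, by omega, hE.le, by simpa [hE] using hs, rfl⟩) J k hk
  rw [hKd] at hg'
  obtain ⟨c, hc⟩ := sum_rep (fun Es Fs => itc Lb (Lw Lo Es) Fs) hg'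
  refine ⟨g, hg, c, fun w => ?_⟩
  have := congrArg (fun P : Module.End ℂ S => P w) hc
  simpa only [LinearMap.sum_apply, LinearMap.smul_apply, smul_eq_mul] using this

/-- evaluation at a point -/
def ev {m : ℕ} (Ω : Set (Fin m → ℝ)) (x : Fin m → ℝ) : SS Ω →+* ℂ :=
  (Pi.evalRingHom (fun _ => ℂ) x).comp (SS Ω).val.toRingHom

lemma ev_apply {m : ℕ} (Ω : Set (Fin m → ℝ)) (x : Fin m → ℝ) (f : SS Ω) : ev Ω x f = f.1 x := rfl

lemma ev_alg {m : ℕ} (Ω : Set (Fin m → ℝ)) (x : Fin m → ℝ) (z : ℂ) :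
    ev Ω x (algebraMap ℂ (SS Ω) z) = z := rfl

lemma main_op (n : ℕ) (hn : 0 < n)
    (Ω : Set (Fin (2 * n + 1) → ℝ))
    (T : VF (2 * n + 1)) (L : Fin n → VF (2 * n + 1))
    (lv : Fin n → Fin n → (Fin (2 * n + 1) → ℝ) → ℂ)
    (hb : Fin n → (Fin (2 * n + 1) → ℝ) → ℂ)
    (hF : NFrame n Ω T L lv hb)
    (aC : Fin n → List (Fin n) → (Fin (2 * n + 1) → ℝ) → ℂ)
    (haC : ∀ (E : Fin n) (Fs : List (Fin n)), 1 ≤ Fs.length → ∀ x ∈ Ω,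
      vItcBar L (L E) Fs x = fun i => aC E Fs x * T x i)
    (haCsmooth : ∀ E Fs, ContDiffOn ℝ (⊤ : ℕ∞) (aC E Fs) Ω)
    (ℓ₀ : ℕ) (hℓ₀ : 1 ≤ ℓ₀)
    (hvan : ∀ (E : Fin n) (Fs : List (Fin n)), 1 ≤ Fs.length → Fs.length < ℓ₀ →
      aC E Fs 0 = 0)
    (hnz : ∃ Fs : List (Fin n), Fs.length = ℓ₀ ∧ aC ⟨0, hn⟩ Fs 0 ≠ 0)
    (J : List (Fin n)) (k : ℕ) (hk : 1 ≤ k)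
    (Lo Lb : Fin n → Module.End ℂ (SS Ω)) (To : Module.End ℂ (SS Ω))
    (hLo : Lo = fun F => vop hF.open_Ω (L F) (hF.smoothL F))
    (hLb : Lb = fun F => vop hF.open_Ω (vconj (L F)) (vconj_smooth (hF.smoothL F)))
    (hTo : To = vop hF.open_Ω T hF.smoothT) :
    ∃ g : SS Ω, g.1 0 = 1 ∧ ∃ c : List (Fin n) → List (Fin n) → SS Ω,
      ∀ w : SS Ω, g * (Lw Lo J * To ^ k) w = ∑ m' ∈ Finset.Icc 1 (J.length + k),
      ∑ s ∈ Finset.range (m' * ℓ₀ + 1), ∑ Es : Fin m' → Fin n, ∑ Fs : Fin s → Fin n,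
        c (List.ofFn Es) (List.ofFn Fs) * itc Lb (Lw Lo (List.ofFn Es)) (List.ofFn Fs) w := by
  obtain ⟨aS, haS⟩ : ∃ aS : Fin n → List (Fin n) → SS Ω, ∀ E Fs, (aS E Fs).1 = aC E Fs :=
    ⟨fun E Fs => ⟨aC E Fs, haCsmooth E Fs⟩, fun _ _ => rfl⟩
  have h1 : ∀ E Fs, 1 ≤ Fs.length → itc Lb (Lo E) Fs = aS E Fs • To := by
    intro E Fs hFs
    obtain ⟨h, h'⟩ := vItc_op hF.open_Ω hF.smoothL Fs (L E) (hF.smoothL E)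
    rw [hLb, hLo, hTo, ← h']
    refine vop_congr _ _ _ _ ?_
    rw [haS]
    exact haC E Fs hFs
  have h2 : ∀ i, ∃ c : SS Ω, Lo i * To - To * Lo i = c • To := by
    intro i
    obtain ⟨c, hc, hc'⟩ := hF.commLT i
    refine ⟨⟨c, hc⟩, ?_⟩
    rw [hLo, hTo, ← vop_brk]
    exact vop_congr _ _ _ _ hc'
  have h3 : ∀ i j, Lb i * Lb j = Lb j * Lb i := by
    intro i j
    rw [← sub_eq_zero, hLb, ← vop_brk, ← zero_smul (SS Ω) (vop hF.open_Ω T hF.smoothT)]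
    refine vop_congr _ _ _ _ fun x hx => ?_
    rw [vbrk_conj hF.open_Ω (hF.smoothL i) (hF.smoothL j) hx]
    funext k
    simp [vconj, hF.commLL i j x hx]
  have hT0 : T 0 ≠ 0 := (hF.indep 0 hF.mem0).ne_zero (Sum.inl 0)
  have h4 : ∀ E F F', 1 ≤ F.length → F.Perm F' → aC E F 0 = aC E F' 0 := by
    intro E F F' hl hp
    have e := itc_perm Lb h3 (Lo E) hp
    rw [h1 E F hl, h1 E F' (by rw [← hp.length_eq]; exact hl)] at e
    obtain ⟨i, hi⟩ := Function.ne_iff.1 hT0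
    obtain ⟨w, hwe⟩ : ∃ w : SS Ω, w.1 = fun y => (y i : ℂ) := ⟨⟨fun y => (y i : ℂ),
      (Complex.ofRealCLM.contDiff.comp (contDiff_apply ℝ ℝ i)).contDiffOn⟩, rfl⟩
    have hw : (To w).1 0 = T 0 i := by
      rw [hTo, vop_in _ _ _ hF.mem0, vapp]
      have : HasFDerivAt w.1 (Complex.ofRealCLM.comp (ContinuousLinearMap.proj (R := ℝ)
          (φ := fun _ : Fin (2 * n + 1) => ℝ) i)) 0 := by
        rw [hwe]
        exact (Complex.ofRealCLM.comp (ContinuousLinearMap.proj (R := ℝ)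
          (φ := fun _ : Fin (2 * n + 1) => ℝ) i)).hasFDerivAt
      rw [this.fderiv, Finset.sum_eq_single i]
      · simp
      · intro j _ hj
        simp [hj.symm]
      · simp
    have e2 : (aS E F).1 0 * (To w).1 0 = (aS E F').1 0 * (To w).1 0 :=
      congrArg (fun P : Module.End ℂ (SS Ω) => (P w).1 0) e
    rw [hw, haS, haS] at e2
    exact mul_right_cancel₀ hi e2
  obtain ⟨F0, hF0, hF0'⟩ := hnz
  obtain ⟨v, hv⟩ := polar (l := ℓ₀) (fun F => aC ⟨0, hn⟩ F 0)
    (fun F F' hl hp => h4 _ F F' (by omega) hp) F0 hF0 hF0'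
  have hset : Setup Lo To (RingHom.ker (ev Ω 0))
      (fun E => ∑ F : Fin ℓ₀ → Fin n, ((List.ofFn F).map v).prod * aC E (List.ofFn F) 0)
      (dl Lb v) ℓ₀ := by
    refine ⟨?_, ?_, h2, dl_der Lb v, hℓ₀, ?_, ?_⟩
    · intro i; rw [hLo]; exact vop_der _ _
    · rw [hTo]; exact vop_der _ _
    · intro f
      refine ⟨f.1 0, ?_⟩
      rw [RingHom.mem_ker, map_sub, ev_apply, ev_alg, sub_self]
    · intro i r hr
      refine ⟨∑ F : Fin r → Fin n, ((List.ofFn F).map v).prod • aS i (List.ofFn F), ?_, ?_, ?_⟩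
      · rw [dl_pow, Finset.sum_smul]
        refine Finset.sum_congr rfl fun F _ => ?_
        rw [h1 _ _ (by simpa using hr), smul_assoc]
      · intro hrl
        refine Ideal.sum_mem _ fun F _ => ?_
        rw [Algebra.smul_def]
        refine Ideal.mul_mem_left _ _ ?_
        rw [RingHom.mem_ker, ev_apply, haS]
        exact hvan i _ (by simpa using hr) (by simpa using hrl)
      · rintro rfl
        rw [RingHom.mem_ker, map_sub, map_sum, sub_eq_zero, ev_alg]
        refine Finset.sum_congr rfl fun F _ => ?_
        rw [Algebra.smul_def, map_mul, ev_alg, ev_apply, haS]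
  obtain ⟨g, hg, c, hc⟩ := final2 hset ⟨0, hn⟩ hv J k hk
  rw [RingHom.mem_ker, map_sub, map_one, sub_eq_zero, ev_apply] at hg
  exact ⟨g, hg, c, hc⟩

lemma exists_ext {m : ℕ} (Ω : Set (Fin m → ℝ)) {W : Set (Fin m → ℝ)} (hW : IsOpen W)
    {u : (Fin m → ℝ) → ℂ} (hu : ContDiffOn ℝ (⊤ : ℕ∞) u W) {x} (hx : x ∈ W) :
    ∃ w : SS Ω, u =ᶠ[𝓝 x] w.1 := by
  obtain ⟨f, hf1, hf2⟩ : ∃ f : ContDiffBump x, tsupport f ⊆ W ∧ True := by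
    obtain ⟨r, hr, hr'⟩ := Metric.isOpen_iff.1 hW x hx
    refine ⟨⟨r / 4, r / 2, by linarith, by linarith⟩, ?_, trivial⟩
    rw [ContDiffBump.tsupport_eq]
    exact (Metric.closedBall_subset_ball (by simp; linarith)).trans hr'
  have hs : ContDiff ℝ (⊤ : ℕ∞) (fun y => f y • u y) := by
    rw [contDiff_iff_contDiffAt]
    intro y
    by_cases hy : y ∈ W
    · exact (f.contDiff.contDiffAt).smul (hu.contDiffAt (hW.mem_nhds hy))
    · have : y ∉ tsupport f := fun h => hy (hf1 h)
      rw [notMem_tsupport_iff_eventuallyEq] at this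
      refine (contDiffAt_const (c := (0 : ℂ))).congr_of_eventuallyEq ?_
      filter_upwards [this] with z hz
      simp [hz]
  refine ⟨⟨_, hs.contDiffOn⟩, ?_⟩
  filter_upwards [f.eventuallyEq_one] with z hz
  simp [hz]

end P14


end

/-- Proposition 3.18, identity (3.19).  With `a_{E,F̄₁…F̄_s}` defined by
`[⋯[[L_E, L_F̄₁], …], L_F̄_s] = a_{E,F̄₁…F̄_s}·T` (`s ≥ 1`), vanishing at `0` for `s < ℓ₀`
and with `a_{1,F̄₁…F̄_{ℓ₀}}(0) ≠ 0` for some choice of `F`'s, every operator `L^J ∘ T^k`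
(`k ≥ 1`) is, near `0`, a combination with smooth coefficients of iterated operator
commutators `[⋯[[L_{E₁}∘⋯∘L_{E_m}, L_F̄₁], …], L_F̄_s]` with `1 ≤ m ≤ |J|+k`,
`0 ≤ s ≤ m·ℓ₀`. -/
theorem statement14 (n : ℕ) (hn : 0 < n)
    (Ω : Set (Fin (2 * n + 1) → ℝ))
    (T : VF (2 * n + 1)) (L : Fin n → VF (2 * n + 1))
    (lv : Fin n → Fin n → (Fin (2 * n + 1) → ℝ) → ℂ)
    (hb : Fin n → (Fin (2 * n + 1) → ℝ) → ℂ)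
    (hF : NFrame n Ω T L lv hb)
    (aC : Fin n → List (Fin n) → (Fin (2 * n + 1) → ℝ) → ℂ)
    (haC : ∀ (E : Fin n) (Fs : List (Fin n)), 1 ≤ Fs.length → ∀ x ∈ Ω,
      vItcBar L (L E) Fs x = fun i => aC E Fs x * T x i)
    (haCsmooth : ∀ E Fs, ContDiffOn ℝ (⊤ : ℕ∞) (aC E Fs) Ω)
    (ℓ₀ : ℕ) (hℓ₀ : 1 ≤ ℓ₀)
    (hvan : ∀ (E : Fin n) (Fs : List (Fin n)), 1 ≤ Fs.length → Fs.length < ℓ₀ →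
      aC E Fs 0 = 0)
    (hnz : ∃ Fs : List (Fin n), Fs.length = ℓ₀ ∧ aC ⟨0, hn⟩ Fs 0 ≠ 0) :
    ∀ (J : List (Fin n)) (k : ℕ), 1 ≤ k →
      ∃ V : Set (Fin (2 * n + 1) → ℝ), IsOpen V ∧ (0 : Fin (2 * n + 1) → ℝ) ∈ V ∧ V ⊆ Ω ∧
      ∃ aa : List (Fin n) → List (Fin n) → (Fin (2 * n + 1) → ℝ) → ℂ,
        (∀ Es Fs, ContDiffOn ℝ (⊤ : ℕ∞) (aa Es Fs) V) ∧
        ∀ (u : (Fin (2 * n + 1) → ℝ) → ℂ) (W : Set (Fin (2 * n + 1) → ℝ)),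
          IsOpen W → ContDiffOn ℝ (⊤ : ℕ∞) u W → ∀ x ∈ V ∩ W,
          (∑ m' ∈ Finset.Icc 1 (J.length + k), ∑ s ∈ Finset.range (m' * ℓ₀ + 1),
            ∑ Es : Fin m' → Fin n, ∑ Fs : Fin s → Fin n,
              aa (List.ofFn Es) (List.ofFn Fs) x *
                opItcBar L (appOp L (List.ofFn Es)) (List.ofFn Fs) u x) =
            appOp L J ((opOf T)^[k] u) x := by
  intro J k hk
  have hΩ := hF.open_Ω
  obtain ⟨g, hg, c, hc⟩ := P14.main_op n hn Ω T L lv hb hF aC haC haCsmooth ℓ₀ hℓ₀ hvan hnz J k hk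
    _ _ _ rfl rfl rfl
  refine ⟨Ω ∩ g.1 ⁻¹' {0}ᶜ, ?_, ⟨hF.mem0, ?_⟩, Set.inter_subset_left,
    fun Es Fs x => (c Es Fs).1 x / g.1 x, ?_, ?_⟩
  · exact (P14.SS_sm g).continuousOn.isOpen_inter_preimage hΩ isOpen_compl_singleton
  · simp [hg]
  · intro Es Fs
    simp only [div_eq_mul_inv]
    exact ((P14.SS_sm (c Es Fs)).mono Set.inter_subset_left).mul
      (ContDiffOn.inv ((P14.SS_sm g).mono Set.inter_subset_left) (fun x hx => hx.2))
  · rintro u W hW hu x ⟨⟨hxΩ, hxg⟩, hxW⟩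
    have hxg' : g.1 x ≠ 0 := hxg
    obtain ⟨w, hw⟩ := P14.exists_ext Ω hW hu hxW
    have hLo := fun F => P14.Rel.vop hΩ (hF.smoothL F)
    have hLb := fun F => P14.Rel.vop hΩ (P14.vconj_smooth (hF.smoothL F))
    have hTo := P14.Rel.vop hΩ hF.smoothT
    have r1 := (P14.Rel.appOp hΩ hLo J).comp hΩ (hTo.pow hΩ k)
    have r2 := fun Es Fs => P14.Rel.itc hΩ hLb Fs (P14.Rel.appOp hΩ hLo Es)
    have e1 := (r1.loc u w.1 x hw).trans (r1.eq w x hxΩ)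
    have e2 := fun Es Fs => ((r2 Es Fs).loc u w.1 x hw).trans ((r2 Es Fs).eq w x hxΩ)
    refine Eq.trans ?_ e1.symm
    have e3 := congrArg (P14.ev Ω x) (hc w)
    simp only [map_sum, map_mul] at e3
    simp only [e2]
    rw [← mul_right_inj' hxg']
    refine Eq.trans ?_ e3.symm
    simp only [Finset.mul_sum]
    refine Finset.sum_congr rfl fun a _ => Finset.sum_congr rfl fun b _ =>
      Finset.sum_congr rfl fun d _ => Finset.sum_congr rfl fun e _ => ?_
    rw [← mul_assoc, mul_div_cancel₀ _ hxg']
    rfl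
end
end

section
/- Let R be an associative ring, let m ≥ 1 and s ≥ 0 be integers, and let a₁, …, a_m, b₁, …, b_s ∈ R. For x ∈ R and a finite sequence c₁, …, c_l ∈ R write C(x; c₁, …, c_l) := [⋯[[x, c₁], c₂] ⋯, c_l] for the iterated commutator ([u, v] := uv − vu, with C(x; ) := x for the empty sequence). Then [⋯[[a₁ a₂ ⋯ a_m, b₁], b₂] ⋯, b_s] = Σ_φ C(a₁; b_{φ,1})·C(a₂; b_{φ,2}) ⋯ C(a_m; b_{φ,m}), where φ ranges over all functions {1, …, s} → {1, …, m} and b_{φ,t} denotes the subsequence (b_i)_{i ∈ φ^{−1}(t)} taken in increasing order of i. -/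
/-- Iterated ring commutator `C(x; c₁,…,c_l) = [⋯[[x,c₁],c₂]⋯,c_l]`, bracketing with the
elements of the list in order (empty list gives `x` itself). -/
def iterComm {R : Type*} [NonUnitalRing R] (x : R) : List R → R
  | [] => x
  | c :: cs => iterComm (x * c - c * x) cs

/-- Product of a nonempty list of ring elements, given as a head `x` and a tail. -/
def prodNE {R : Type*} [NonUnitalRing R] (x : R) : List R → R
  | [] => x
  | y :: ys => prodNE (x * y) ys

theorem prodNE_mul_left {R : Type*} [NonUnitalRing R] (x y : R) (l : List R) :
    prodNE (x * y) l = x * prodNE y l := by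
  induction l generalizing y with
  | nil => rfl
  | cons z l ih => simp only [prodNE]; rw [mul_assoc, ih]

theorem iterComm_sum {R : Type*} [NonUnitalRing R] {ι : Type*} (S : Finset ι) (f : ι → R)
    (l : List R) : iterComm (∑ i ∈ S, f i) l = ∑ i ∈ S, iterComm (f i) l := by
  induction l generalizing f with
  | nil => rfl
  | cons c l ih =>
    simp only [iterComm]
    rw [← ih, Finset.sum_mul, Finset.mul_sum, Finset.sum_sub_distrib]

def prodFin {R : Type*} [NonUnitalRing R] {m : ℕ} (a : Fin (m + 1) → R) : R :=
  prodNE (a 0) (List.ofFn fun i : Fin m => a i.succ)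

theorem prodFin_succ {R : Type*} [NonUnitalRing R] {m : ℕ} (a : Fin (m + 2) → R) :
    prodFin a = a 0 * prodFin (fun i => a i.succ) := by
  simp only [prodFin, List.ofFn_succ (n := m), prodNE, prodNE_mul_left]

theorem prodFin_comm {R : Type*} [NonUnitalRing R] {m : ℕ} (a : Fin (m + 1) → R) (c : R) :
    prodFin a * c - c * prodFin a =
      ∑ t, prodFin (Function.update a t (a t * c - c * a t)) := by
  induction m with
  | zero => simp [prodFin, prodNE]
  | succ m ih =>
    rw [Fin.sum_univ_succ]
    have h1 : ∀ t : Fin (m + 1), prodFin (Function.update a t.succ (a t.succ * c - c * a t.succ))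
        = a 0 * prodFin (Function.update (fun i => a i.succ) t
          (a t.succ * c - c * a t.succ)) := by
      intro t
      have h2 : (fun i : Fin (m + 1) => Function.update a t.succ
          (a t.succ * c - c * a t.succ) i.succ) =
          Function.update (fun i => a i.succ) t (a t.succ * c - c * a t.succ) := by
        funext i
        simp [Function.update_apply]
      rw [prodFin_succ, h2, Function.update_of_ne (Fin.succ_ne_zero t).symm]
    rw [Finset.sum_congr rfl (fun t _ => h1 t), ← Finset.mul_sum, ← ih (fun i => a i.succ)]
    rw [prodFin_succ, prodFin_succ]
    simp only [Function.update_self, ne_eq, Fin.succ_ne_zero, not_false_eq_true,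
      Function.update_of_ne]
    noncomm_ring

theorem main_aux {R : Type*} [NonUnitalRing R] (m s : ℕ)
    (a : Fin (m + 1) → R) (b : Fin s → R) :
    iterComm (prodFin a) (List.ofFn b) =
      ∑ φ : Fin s → Fin (m + 1),
        prodFin fun t => iterComm (a t) (((List.finRange s).filter fun i => φ i = t).map b) := by
  induction s generalizing a with
  | zero => simp [iterComm]
  | succ s ih =>
    rw [List.ofFn_succ, iterComm, prodFin_comm, iterComm_sum,
      ← (Fin.consEquiv (fun _ : Fin (s + 1) => Fin (m + 1))).sum_comp, Fintype.sum_prod_type]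
    refine Finset.sum_congr rfl fun t _ => ?_
    rw [ih]
    refine Finset.sum_congr rfl fun ψ _ => ?_
    congr 1
    funext j
    rw [List.finRange_succ, List.filter_cons]
    by_cases h : t = j
    · subst h
      simp [Fin.consEquiv, List.filter_map, iterComm, Function.comp_def]
    · simp [Fin.consEquiv, List.filter_map, Function.comp_def, h, Function.update_of_ne (Ne.symm h)]

/-- In any associative (not necessarily unital or commutative) ring, for
`m ≥ 1` elements `a₁, …, a_m` (here indexed by `Fin (m+1)`, so there are `m+1 ≥ 1` of them)
and elements `b₁, …, b_s`, the iterated commutator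
`[⋯[[a₁⋯a_m, b₁], b₂]⋯, b_s]` equals the sum over all functions
`φ : {1,…,s} → {1,…,m}` of the products `C(a₁; b_{φ,1})·C(a₂; b_{φ,2})⋯C(a_m; b_{φ,m})`,
where `b_{φ,t}` is the increasing subsequence of the `b_i` with `φ i = t`. -/
theorem statement16 {R : Type*} [NonUnitalRing R] (m s : ℕ)
    (a : Fin (m + 1) → R) (b : Fin s → R) :
    iterComm (prodNE (a 0) (List.ofFn fun i : Fin m => a i.succ)) (List.ofFn b) =
      ∑ φ : Fin s → Fin (m + 1),
        prodNE (iterComm (a 0) (((List.finRange s).filter fun i => φ i = 0).map b))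
          (List.ofFn fun t : Fin m =>
            iterComm (a t.succ) (((List.finRange s).filter fun i => φ i = t.succ).map b)) := by
  exact main_aux m s a b
end
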